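/- arXiv:2505.21120 — 2 statements merged into one kernel-verified Lean document; each statement's English description precedes it below -/
import Mathlib

section
/- Let γ ∈ [-3,-2]. Let g₀ be a probability density on ℝ³ with k e^{−μ|v|²} ≤ g₀(v) ≤ K e^{−μ|v|²} for some μ, k, K > 0, such that ln g₀ is locally C^{2+δ} for some δ ∈ (0,1) and sup_{i,j} [∂_{ij} ln g₀]_{δ,B(0,R)} ≤ C_g R^ℓ for all R ≥ 1, for some ℓ ∈ ℝ and C_g > 0. Let α ∈ (0,δ], v ∈ ℝ³ and r = (1/2)⟨v⟩^{−β} with β = max(2 + (ℓ−2)/(2+δ), 1). Then [g₀]*_{2+α,Σ_r(v)} ≤ C ‖g₀‖_{L^∞(Σ_r(v))} ⟨v⟩^{−βα+σ}, where σ = max(2 + α(ℓ−2)/(2+δ), 2−α) and C > 0 depends on the constant C_g. -/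
noncomputable section

open MeasureTheory Real
open scoped ENNReal RealInnerProductSpace

/-- The velocity space ℝ³. -/
abbrev V3 : Type := EuclideanSpace ℝ (Fin 3)

/-- 3×3 real matrices. -/
abbrev Mat3 : Type := Matrix (Fin 3) (Fin 3) ℝ

/-- Japanese bracket ⟨v⟩ = √(1+|v|²). -/
def jap (v : V3) : ℝ := Real.sqrt (1 + ‖v‖ ^ 2)

/-- `i`-th basis vector of ℝ³. -/
def esingle (i : Fin 3) : V3 := EuclideanSpace.single i (1 : ℝ)

/-- Orthogonal projection Π(z) onto z^⊥. -/
def proj (z : V3) : Mat3 := fun i j =>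
  (if i = j then (1 : ℝ) else 0) - (z i / ‖z‖) * (z j / ‖z‖)

/-- Landau kernel a(z) = |z|^{γ+2} Π(z). -/
def landauKernel (γ : ℝ) (z : V3) : Mat3 := fun i j => ‖z‖ ^ (γ + 2) * proj z i j

/-- Cut-off kernel ã(z) = ⟨z⟩^γ |z|² Π(z). -/
def cutoffKernel (γ : ℝ) (z : V3) : Mat3 := fun i j => jap z ^ γ * ‖z‖ ^ 2 * proj z i j

/-- Bilinear form ⟨A w, z⟩. -/
def bilin (A : Mat3) (w z : V3) : ℝ := ∑ i, ∑ j, A i j * w i * z j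

/-- Quadratic form A : w^{⊗2}. -/
def quadForm (A : Mat3) (w : V3) : ℝ := bilin A w w

/-- Matrix dot product A : B. -/
def matDot (A B : Mat3) : ℝ := ∑ i, ∑ j, A i j * B i j

/-- (Frobenius) norm of a 3×3 matrix. -/
def matNorm (A : Mat3) : ℝ := Real.sqrt (∑ i, ∑ j, (A i j) ^ 2)

/-- Entropy H(f) = ∫ f ln f. -/
def entropy (f : V3 → ℝ) : ℝ := ∫ v, f v * Real.log (f v)

/-- Relative entropy H(f|g) = ∫ ((f/g) ln(f/g) − f/g + 1) g ∈ [0,∞]. -/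
def relEntropy (f g : V3 → ℝ) : ℝ≥0∞ :=
  ∫⁻ v, ENNReal.ofReal ((f v / g v * Real.log (f v / g v) - f v / g v + 1) * g v)

/-- Hessian matrix of a function on ℝ³. -/
def hess (φ : V3 → ℝ) (v : V3) : Mat3 := fun i j =>
  iteratedFDeriv ℝ 2 φ v ![esingle i, esingle j]

/-- Hessian matrix within a set. -/
def hessW (φ : V3 → ℝ) (s : Set V3) (v : V3) : Mat3 := fun i j =>
  iteratedFDerivWithin ℝ 2 φ s v ![esingle i, esingle j]

/-- Gradient of the logarithm, ∇ ln φ. -/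
def logGrad (φ : V3 → ℝ) (v : V3) : V3 := gradient (fun w => Real.log (φ w)) v

/-- Hessian of the logarithm, ∇² ln φ. -/
def logHess (φ : V3 → ℝ) (v : V3) : Mat3 := hess (fun w => Real.log (φ w)) v

/-- `G` is the weak gradient of `F` on ℝ⁶ ≃ ℝ³ × ℝ³. -/
def IsWeakGrad6 (F : V3 × V3 → ℝ) (G : V3 × V3 → V3 × V3) : Prop :=
  ∀ φ : V3 × V3 → ℝ, ContDiff ℝ (⊤ : ℕ∞) φ → HasCompactSupport φ →
    ∀ e : V3 × V3,
      (∫ p : V3 × V3, F p * fderiv ℝ φ p e) =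
        - ∫ p : V3 × V3, (⟪(G p).1, e.1⟫ + ⟪(G p).2, e.2⟫) * φ p

/-- `G` is the weak gradient of `F` on ℝ³. -/
def IsWeakGrad3 (F : V3 → ℝ) (G : V3 → V3) : Prop :=
  ∀ φ : V3 → ℝ, ContDiff ℝ (⊤ : ℕ∞) φ → HasCompactSupport φ →
    ∀ e : V3, (∫ v, F v * fderiv ℝ φ v e) = - ∫ v, ⟪G v, e⟫ * φ v

/-- Entropy production functional associated with a weak gradient of √(f f'). -/
def dissipation (γ : ℝ) (G : V3 × V3 → V3 × V3) : ℝ≥0∞ :=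
  ∫⁻ p : V3 × V3,
    ENNReal.ofReal (quadForm (landauKernel γ (p.1 - p.2)) ((G p).1 - (G p).2))

/-- Villani's H-solutions of the Landau equation on [0,T], with weak gradient data
`fGrad s` for √(f_s f_s'). -/
structure IsHSolution (γ T : ℝ) (f : ℝ → V3 → ℝ) (fGrad : ℝ → V3 × V3 → V3 × V3) : Prop where
  nonneg : ∀ t ∈ Set.Icc 0 T, ∀ v, 0 ≤ f t v
  integrable : ∀ t ∈ Set.Icc 0 T, Integrable (f t)
  entIntegrable : ∀ t ∈ Set.Icc 0 T, Integrable (fun v => f t v * Real.log (f t v))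
  contDistrib : ∀ φ : V3 → ℝ, ContDiff ℝ (⊤ : ℕ∞) φ → HasCompactSupport φ →
    ContinuousOn (fun t => ∫ v, φ v * f t v) (Set.Icc 0 T)
  mass : ∀ t ∈ Set.Icc 0 T, (∫ v, f t v) = 1
  momentumIntegrable : ∀ t ∈ Set.Icc 0 T, Integrable (fun v => f t v • v)
  momentum : ∀ t ∈ Set.Icc 0 T, (∫ v, f t v • v) = ∫ v, f 0 v • v
  energyIntegrable : ∀ t ∈ Set.Icc 0 T, Integrable (fun v => ‖v‖ ^ 2 * f t v)
  energy : ∀ t ∈ Set.Icc 0 T, (∫ v, ‖v‖ ^ 2 * f t v) = ∫ v, ‖v‖ ^ 2 * f 0 v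
  weakGrad : ∀ᵐ s ∂(volume.restrict (Set.Icc 0 T)),
    IsWeakGrad6 (fun p => Real.sqrt (f s p.1 * f s p.2)) (fGrad s)
  dissipationFinite : ∀ t ∈ Set.Icc 0 T,
    (∫⁻ s in Set.Ioc (0 : ℝ) t, dissipation γ (fGrad s)) < ⊤
  entropyProd : ∀ t ∈ Set.Icc 0 T,
    entropy (f t) + 2 * (∫⁻ s in Set.Ioc (0 : ℝ) t, dissipation γ (fGrad s)).toReal ≤
      entropy (f 0)
  weakForm : ∀ φ : ℝ → V3 → ℝ,
    ContDiff ℝ 2 (fun q : ℝ × V3 => φ q.1 q.2) →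
    HasCompactSupport (fun q : ℝ × V3 => φ q.1 q.2) →
    ∀ t ∈ Set.Icc 0 T,
      (∫ v, φ t v * f t v) - (∫ v, φ 0 v * f 0 v) =
        (∫ s in (0 : ℝ)..t, ∫ v, deriv (fun r => φ r v) s * f s v) -
          ∫ s in (0 : ℝ)..t, ∫ p : V3 × V3,
            bilin (landauKernel γ (p.1 - p.2))
              (gradient (φ s) p.1 - gradient (φ s) p.2)
              ((fGrad s p).1 - (fGrad s p).2) * Real.sqrt (f s p.1 * f s p.2)

/-- Convolved Landau matrix ā = a ⋆ f. -/
def abar (γ : ℝ) (f : V3 → ℝ) (v : V3) : Mat3 := fun i j =>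
  ∫ w, landauKernel γ (v - w) i j * f w

/-- Zero order coefficient c̄ of the Landau equation in nondivergence form. -/
def cbar (γ : ℝ) (f : V3 → ℝ) (v : V3) : ℝ :=
  if γ = -3 then 8 * Real.pi * f v else 2 * (γ + 3) * ∫ w, ‖v - w‖ ^ γ * f w

/-- Convolution of the cut-off kernel with a density. -/
def cutoffConv (γ : ℝ) (f : V3 → ℝ) (v : V3) : Mat3 := fun i j =>
  ∫ w, cutoffKernel γ (v - w) i j * f w

/-- Classical solution of the Landau equation on a time set `I`
(in nondivergence parabolic form ∂_t g = ā : ∇²g + c̄ g). -/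
structure IsClassicalSolution (γ : ℝ) (I : Set ℝ) (g : ℝ → V3 → ℝ) : Prop where
  pos : ∀ t ∈ I, ∀ v, 0 < g t v
  timeC1 : ∀ v, ContDiffOn ℝ 1 (fun t => g t v) I
  velC2 : ∀ t ∈ I, ContDiff ℝ 2 (g t)
  eqn : ∀ t ∈ I, ∀ v,
    derivWithin (fun s => g s v) I t =
      matDot (abar γ (g t) v) (hess (g t) v) + cbar γ (g t) v * g t v

/-- The moment exponent ρ = max(2κ, 2κ+2γ+4, 2ζ, ν). -/
def rhoExp (γ κ ζ ν : ℝ) : ℝ := max (max (2 * κ) (2 * κ + 2 * γ + 4)) (max (2 * ζ) ν)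

/-- Setting (⋆) of the paper. -/
structure Setting (γ T : ℝ) where
  f : ℝ → V3 → ℝ
  fGrad : ℝ → V3 × V3 → V3 × V3
  g : ℝ → V3 → ℝ
  κ : ℝ
  ν : ℝ
  ζ : ℝ
  K1 : ℝ → ℝ
  K2 : ℝ → ℝ
  K3 : ℝ → ℝ
  Mf : ℝ
  Mg : ℝ
  hγ : γ ∈ Set.Ico (-3 : ℝ) 0
  hT : 0 < T
  hf : IsHSolution γ T f fGrad
  hg : IsClassicalSolution γ (Set.Icc 0 T) g
  hκ : 1 ≤ κ
  hν : 1 ≤ ν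
  hζ : 0 ≤ ζ
  K1nonneg : ∀ t, 0 ≤ K1 t
  K2nonneg : ∀ t, 0 ≤ K2 t
  K3nonneg : ∀ t, 0 ≤ K3 t
  K1meas : Measurable K1
  K2meas : Measurable K2
  K3meas : Measurable K3
  K1bound : ∀ t ∈ Set.Icc 0 T, ∀ v, ‖logGrad (g t) v‖ ≤ K1 t * jap v ^ κ
  K2bound : ∀ t ∈ Set.Icc 0 T, ∀ v,
    |derivWithin (fun s => Real.log (g s v)) (Set.Icc 0 T) t| ≤ K2 t * jap v ^ ν
  K3bound : ∀ t ∈ Set.Icc 0 T, ∀ v, matNorm (logHess (g t) v) ≤ K3 t * jap v ^ ζ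
  Kint : IntegrableOn (fun t => K2 t + K1 t ^ 2 + K3 t ^ 2) (Set.Icc 0 T)
  fMomentInt : ∀ t ∈ Set.Icc 0 T,
    Integrable (fun v => jap v ^ (rhoExp γ κ ζ ν - γ) * f t v)
  fMoment : ∀ t ∈ Set.Icc 0 T, (∫ v, jap v ^ (rhoExp γ κ ζ ν - γ) * f t v) ≤ Mf
  gMomentInt : ∀ t ∈ Set.Icc 0 T,
    Integrable (fun v => jap v ^ (rhoExp γ κ ζ ν - γ) * g t v)
  gMoment : ∀ t ∈ Set.Icc 0 T, (∫ v, jap v ^ (rhoExp γ κ ζ ν - γ) * g t v) ≤ Mg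

/-- The good term 𝒢_s. -/
def goodTerm (γ : ℝ) (f g : ℝ → V3 → ℝ) (fGrad : ℝ → V3 × V3 → V3 × V3) (s : ℝ) : ℝ :=
  2 * ∫ p : V3 × V3,
    quadForm (landauKernel γ (p.1 - p.2))
      (((fGrad s p).1 - (fGrad s p).2) -
        Real.sqrt (f s p.1 * f s p.2) • (logGrad (g s) p.1 - logGrad (g s) p.2))

/-- The vector field a(v−v')(∇−∇')(g g'). -/
def landauFlux (γ : ℝ) (g : V3 → ℝ) (v w : V3) : Fin 3 → ℝ := fun i =>
  ∑ j, landauKernel γ (v - w) i j * (g w * (gradient g v) j - g v * (gradient g w) j)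

/-- (∇−∇')·[a(v−v')(∇−∇')(g g')]. -/
def divDiffFlux (γ : ℝ) (g : V3 → ℝ) (v w : V3) : ℝ :=
  ∑ i, (fderiv ℝ (fun z => landauFlux γ g z w i) v (esingle i) -
        fderiv ℝ (fun z => landauFlux γ g v z i) w (esingle i))

/-- The bad term ℬ_s. -/
def badTerm (γ : ℝ) (f g : ℝ → V3 → ℝ) (s : ℝ) : ℝ :=
  (1 / 2) * ∫ p : V3 × V3,
    (f s p.1 - g s p.1) * (f s p.2 - g s p.2) / (g s p.1 * g s p.2) *
      divDiffFlux γ (g s) p.1 p.2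

/-- Weighted relative Fisher information ∫ |2∇√f − √f ∇ln g|² ⟨v⟩^γ dv. -/
def relFisher (γ : ℝ) (f g : V3 → ℝ) (fGrad3 : V3 → V3) : ℝ :=
  ∫ v, ‖(2 : ℝ) • fGrad3 v - Real.sqrt (f v) • logGrad g v‖ ^ 2 * jap v ^ γ

/-- ‖⟨v⟩^{−κ} ∇ ln g_s‖_{L^∞(ℝ³)} ∈ [0,∞]. -/
def gradLogSup (g : ℝ → V3 → ℝ) (κ s : ℝ) : ℝ≥0∞ :=
  ⨆ v : V3, ENNReal.ofReal (jap v ^ (-κ) * ‖logGrad (g s) v‖)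

/-- ‖⟨v⟩^{−ν} ∂_s ln g_s‖_{L^∞(ℝ³)} ∈ [0,∞]. -/
def dtLogSup (g : ℝ → V3 → ℝ) (T ν s : ℝ) : ℝ≥0∞ :=
  ⨆ v : V3, ENNReal.ofReal
    (jap v ^ (-ν) * |derivWithin (fun r => Real.log (g r v)) (Set.Icc 0 T) s|)

/-- ‖⟨v⟩^{−ζ} ∇² ln g_s‖_{L^∞(ℝ³)} ∈ [0,∞]. -/
def hessLogSup (g : ℝ → V3 → ℝ) (ζ s : ℝ) : ℝ≥0∞ :=
  ⨆ v : V3, ENNReal.ofReal (jap v ^ (-ζ) * matNorm (logHess (g s) v))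

/-- Open cube Σ_R(v₀) = v₀ + (−R,R)³. -/
def cube (v₀ : V3) (R : ℝ) : Set V3 := {v | ∀ i, |v i - v₀ i| < R}

/-- Closed cube v₀ + [−R,R]³ centered at the origin. -/
def ccube (R : ℝ) : Set V3 := {v | ∀ i, |v i| ≤ R}

/-- Distance to the boundary of the cube Σ_R(v₀). -/
def dCube (v₀ : V3) (R : ℝ) (v : V3) : ℝ :=
  Finset.univ.inf' (Finset.univ_nonempty) fun i : Fin 3 => R - |v i - v₀ i|

/-- The moment exponent k(γ,ℓ,δ) of Theorem 2. -/
def kExp (γ ℓ δ : ℝ) : ℝ := 8 * (max (2 + (ℓ - 2) / (2 + δ)) 1 + (2 - γ) / (2 * δ)) - γ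

set_option maxHeartbeats 1000000

lemma aux_opnorm (L : V3 →L[ℝ] ℝ) (G : ℝ) (hG : ∀ i, |L (esingle i)| ≤ G) : ‖L‖ ≤ 3 * G := by
  have hG0 : 0 ≤ G := (abs_nonneg _).trans (hG 0)
  refine L.opNorm_le_bound (by positivity) fun x => ?_
  have hx : x = ∑ i, x i • esingle i := by
    ext j
    fin_cases j <;> simp [esingle, Fin.sum_univ_three]
  have hLx : L x = ∑ i, x i * L (esingle i) := by
    conv_lhs => rw [hx]
    simp [map_sum]
  rw [hLx]
  calc ‖∑ i, x i * L (esingle i)‖ ≤ ∑ i, ‖x i * L (esingle i)‖ := norm_sum_le _ _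
    _ ≤ ∑ i : Fin 3, ‖x‖ * G := by
        refine Finset.sum_le_sum fun i _ => ?_
        rw [norm_mul]
        exact mul_le_mul (PiLp.norm_apply_le x i) (hG i) (norm_nonneg _) (norm_nonneg _)
    _ = 3 * G * ‖x‖ := by simp; ring

lemma aux_lip (f : V3 → ℝ) (hf : Differentiable ℝ f) (s : Set V3) (hs : Convex ℝ s) (G : ℝ)
    (hG : ∀ y ∈ s, ∀ i, |fderiv ℝ f y (esingle i)| ≤ G) (a b : V3) (ha : a ∈ s) (hb : b ∈ s) :
    |f a - f b| ≤ 3 * G * ‖a - b‖ :=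
  hs.norm_image_sub_le_of_norm_fderiv_le (fun x _ => hf x)
    (fun x hx => aux_opnorm _ _ (hG x hx)) hb ha

lemma aux_mvt (f : V3 → ℝ) (hf : Differentiable ℝ f) (y e : V3) (r : ℝ) (hr : 0 < r) :
    ∃ s ∈ Set.Ioo 0 r, f (y + r • e) - f y = r * fderiv ℝ f (y + s • e) e := by
  have hd : ∀ t : ℝ, HasDerivAt (fun t : ℝ => f (y + t • e)) (fderiv ℝ f (y + t • e) e) t := by
    intro t
    have h1 : HasDerivAt (fun t : ℝ => y + t • e) e t := by
      simpa using ((hasDerivAt_id t).smul_const e).const_add y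
    exact (hf (y + t • e)).hasFDerivAt.comp_hasDerivAt t h1
  obtain ⟨s, hs, h⟩ := exists_hasDerivAt_eq_slope (fun t : ℝ => f (y + t • e))
    (fun t => fderiv ℝ f (y + t • e) e) hr
    (fun t _ => (hd t).continuousAt.continuousWithinAt) (fun t _ => hd t)
  refine ⟨s, hs, ?_⟩
  simp only [zero_smul, add_zero, sub_zero] at h
  rw [h]
  field_simp

lemma aux_hess (h : V3 → ℝ) (hh : ContDiff ℝ 2 h) (y : V3) (i j : Fin 3) :
    hess h y i j = fderiv ℝ (fun x => fderiv ℝ h x (esingle j)) y (esingle i) := by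
  have hd : DifferentiableAt ℝ (fderiv ℝ h) y :=
    ((hh.fderiv_right (m := 1) (by norm_num)).differentiable (by norm_num)) y
  unfold hess
  rw [iteratedFDeriv_two_apply]
  rw [fderiv_clm_apply hd (differentiableAt_const _)]
  simp

lemma aux_Pdiff (h : V3 → ℝ) (hh : ContDiff ℝ 2 h) (j : Fin 3) :
    Differentiable ℝ (fun x => fderiv ℝ h x (esingle j)) := by
  have hd : Differentiable ℝ (fderiv ℝ h) :=
    ((hh.fderiv_right (m := 1) (by norm_num)).differentiable (by norm_num))
  exact hd.clm_apply (differentiable_const _)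

lemma aux_enorm (i : Fin 3) : ‖esingle i‖ = 1 := by simp [esingle]

lemma aux_step (v y : V3) (i : Fin 3) (a s r : ℝ) (hs : 0 ≤ s) (hsr : s ≤ r)
    (hy : y ∈ Metric.closedBall v a) : y + s • esingle i ∈ Metric.closedBall v (a + r) := by
  rw [mem_closedBall_iff_norm] at *
  have : y + s • esingle i - v = (y - v) + s • esingle i := by abel
  rw [this]
  refine (norm_add_le _ _).trans ?_
  rw [norm_smul, aux_enorm, Real.norm_of_nonneg hs]
  linarith

lemma aux_hessbound (h : V3 → ℝ) (hh : ContDiff ℝ 2 h) (v : V3) (r c0 c1 Lc δ : ℝ)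
    (hr : 0 < r) (hδ : 0 < δ) (hδ1 : δ < 1) (hLc : 0 ≤ Lc)
    (hosc : ∀ y ∈ Metric.closedBall v (5 * r), ∀ y' ∈ Metric.closedBall v (5 * r),
      |h y - h y'| ≤ c1)
    (hhol : ∀ i j, ∀ y ∈ Metric.closedBall v (5 * r), ∀ y' ∈ Metric.closedBall v (5 * r),
      |hess h y i j - hess h y' i j| ≤ Lc * ‖y - y'‖ ^ δ)
    (hc0 : Lc * r ^ (2 + δ) ≤ c0) (y : V3) (hy : y ∈ Metric.closedBall v (3 * r)) (i j : Fin 3) :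
    r ^ 2 * |hess h y i j| ≤ 2 * c1 + 2 * c0 := by
  have hhd : Differentiable ℝ h := hh.differentiable (by norm_num)
  have hsh : Differentiable ℝ (fun x => h (x + r • esingle i)) :=
    hhd.comp (differentiable_id.add_const _)
  obtain ⟨s, hs, e1⟩ := aux_mvt (fun x => h (x + r • esingle i) - h x) (hsh.sub hhd) y
    (esingle j) r hr
  have e2 : fderiv ℝ (fun x => h (x + r • esingle i) - h x) (y + s • esingle j) (esingle j)
      = fderiv ℝ h (y + s • esingle j + r • esingle i) (esingle j)
        - fderiv ℝ h (y + s • esingle j) (esingle j) := by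
    rw [fderiv_fun_sub (hsh _) (hhd _), fderiv_comp_add_right]
    rfl
  obtain ⟨t, ht, e3⟩ := aux_mvt _ (aux_Pdiff h hh j) (y + s • esingle j) (esingle i) r hr
  rw [← aux_hess h hh] at e3
  rw [e2, e3] at e1
  set ξ := y + s • esingle j + t • esingle i with hξ
  have m0 : y ∈ Metric.closedBall v (5 * r) := Metric.closedBall_subset_closedBall (by linarith) hy
  have h54 : 5 * r = 3 * r + r + r := by ring
  have h4 : Metric.closedBall v (3 * r + r) ⊆ Metric.closedBall v (5 * r) :=
    Metric.closedBall_subset_closedBall (by linarith)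
  have mξ : ξ ∈ Metric.closedBall v (5 * r) := by
    rw [h54]
    exact aux_step _ _ _ _ _ _ ht.1.le ht.2.le (aux_step _ _ _ _ _ _ hs.1.le hs.2.le hy)
  have mj := aux_step v y j _ r r hr.le le_rfl hy
  have mi := h4 (aux_step v y i _ r r hr.le le_rfl hy)
  have mji : y + r • esingle j + r • esingle i ∈ Metric.closedBall v (5 * r) := by
    rw [h54]
    exact aux_step _ _ _ _ _ _ hr.le le_rfl mj
  have o1 := abs_le.1 (hosc _ mji _ (h4 mj))
  have o2 := abs_le.1 (hosc _ mi _ m0)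
  have b1 : |r * (r * hess h ξ i j)| ≤ 2 * c1 := by
    rw [← e1, abs_le]
    constructor <;> linarith [o1.1, o1.2, o2.1, o2.2]
  have b1' : r ^ 2 * |hess h ξ i j| ≤ 2 * c1 := by
    rw [abs_mul, abs_mul, abs_of_pos hr] at b1
    linarith
  have nξ : ‖y - ξ‖ ≤ 2 * r := by
    have : y - ξ = -(s • esingle j + t • esingle i) := by rw [hξ]; abel
    rw [this, norm_neg]
    refine (norm_add_le _ _).trans ?_
    rw [norm_smul, norm_smul, aux_enorm, aux_enorm, Real.norm_of_nonneg hs.1.le,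
      Real.norm_of_nonneg ht.1.le]
    linarith [hs.2, ht.2]
  have b2 : |hess h y i j - hess h ξ i j| ≤ Lc * (2 * r ^ δ) := by
    refine (hhol i j y m0 ξ mξ).trans (mul_le_mul_of_nonneg_left ?_ hLc)
    refine (Real.rpow_le_rpow (norm_nonneg _) nξ hδ.le).trans ?_
    rw [Real.mul_rpow (by norm_num) hr.le]
    have : (2 : ℝ) ^ δ ≤ 2 := by
      calc (2 : ℝ) ^ δ ≤ 2 ^ (1 : ℝ) := Real.rpow_le_rpow_of_exponent_le (by norm_num) hδ1.le
        _ = 2 := by norm_num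
    gcongr
  have hp : r ^ (2 + δ) = r ^ 2 * r ^ δ := by
    rw [Real.rpow_add hr]; norm_num
  rw [hp] at hc0
  have b3 : |hess h y i j| ≤ |hess h ξ i j| + Lc * (2 * r ^ δ) := by
    have := abs_add_le (hess h ξ i j) (hess h y i j - hess h ξ i j)
    rw [add_sub_cancel] at this
    linarith
  have b4 := mul_le_mul_of_nonneg_left b3 (sq_nonneg r)
  nlinarith [b4, b1', hc0]

lemma aux_gradbound (h : V3 → ℝ) (hh : ContDiff ℝ 2 h) (v : V3) (r A c1 : ℝ)
    (hr : 0 < r)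
    (hosc : ∀ y ∈ Metric.closedBall v (5 * r), ∀ y' ∈ Metric.closedBall v (5 * r),
      |h y - h y'| ≤ c1)
    (hA : ∀ y ∈ Metric.closedBall v (3 * r), ∀ i j, |hess h y i j| ≤ A)
    (y : V3) (hy : y ∈ Metric.closedBall v (2 * r)) (i : Fin 3) :
    r * |fderiv ℝ h y (esingle i)| ≤ c1 + 3 * (r ^ 2 * A) := by
  have hhd : Differentiable ℝ h := hh.differentiable (by norm_num)
  obtain ⟨s, hs, e⟩ := aux_mvt h hhd y (esingle i) r hr
  have h3 : 3 * r = 2 * r + r := by ring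
  have m0 : y ∈ Metric.closedBall v (3 * r) := Metric.closedBall_subset_closedBall (by linarith) hy
  have ms : y + s • esingle i ∈ Metric.closedBall v (3 * r) := by
    rw [h3]; exact aux_step _ _ _ _ _ _ hs.1.le hs.2.le hy
  have mr : y + r • esingle i ∈ Metric.closedBall v (3 * r) := by
    rw [h3]; exact aux_step _ _ _ _ _ _ hr.le le_rfl hy
  have h35 : Metric.closedBall v (3 * r) ⊆ Metric.closedBall v (5 * r) :=
    Metric.closedBall_subset_closedBall (by linarith)
  have b1 := hosc _ (h35 mr) _ (h35 m0)
  rw [e, abs_mul, abs_of_pos hr] at b1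
  have b2 := aux_lip _ (aux_Pdiff h hh i) _ (convex_closedBall v (3 * r)) A
    (fun x hx j => by rw [← aux_hess h hh]; exact hA x hx j i) _ _ m0 ms
  have hA0 : 0 ≤ A := (abs_nonneg _).trans (hA y m0 i i)
  have n : ‖y - (y + s • esingle i)‖ ≤ r := by
    rw [sub_add_cancel_left, norm_neg, norm_smul, aux_enorm, Real.norm_of_nonneg hs.1.le]
    linarith [hs.2]
  have b3 : |fderiv ℝ h y (esingle i)| ≤ |fderiv ℝ h (y + s • esingle i) (esingle i)|
      + 3 * A * r := by
    have := abs_add_le (fderiv ℝ h (y + s • esingle i) (esingle i))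
      (fderiv ℝ h y (esingle i) - fderiv ℝ h (y + s • esingle i) (esingle i))
    rw [add_sub_cancel] at this
    have : 3 * A * ‖y - (y + s • esingle i)‖ ≤ 3 * A * r := by gcongr
    linarith
  have b4 := mul_le_mul_of_nonneg_left b3 hr.le
  nlinarith

lemma aux_hessexp (g : V3 → ℝ) (hg : ContDiff ℝ 2 g) (hpos : ∀ y, 0 < g y)
    (hh : ContDiff ℝ 2 (fun x => Real.log (g x))) (i j : Fin 3) (y : V3) :
    fderiv ℝ g y (esingle i) = g y * fderiv ℝ (fun x => Real.log (g x)) y (esingle i) ∧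
    hess g y i j = g y * (fderiv ℝ (fun x => Real.log (g x)) y (esingle i)
      * fderiv ℝ (fun x => Real.log (g x)) y (esingle j)
      + hess (fun x => Real.log (g x)) y i j) := by
  have hgd : Differentiable ℝ g := hg.differentiable (by norm_num)
  have h1 : ∀ (i : Fin 3) (y : V3), fderiv ℝ g y (esingle i)
      = g y * fderiv ℝ (fun x => Real.log (g x)) y (esingle i) := by
    intro i y
    rw [fderiv.log (hgd y) (hpos y).ne']
    have := (hpos y).ne'
    simp
    field_simp
  refine ⟨h1 i y, ?_⟩
  rw [aux_hess g hg, aux_hess _ hh]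
  have : (fun x => fderiv ℝ g x (esingle j))
      = fun x => g x * fderiv ℝ (fun x => Real.log (g x)) x (esingle j) := funext (h1 j)
  rw [this, fderiv_fun_mul (hgd y) (aux_Pdiff _ hh j y)]
  simp only [add_apply, smul_apply, smul_eq_mul]
  rw [h1 i y]
  ring

lemma aux_cube_convex (v : V3) (r : ℝ) : Convex ℝ (cube v r) := by
  intro w hw z hz a b ha hb hab i
  have h1 : w i ∈ Set.Ioo (v i - r) (v i + r) := by
    have := abs_lt.1 (hw i); constructor <;> linarith [this.1, this.2]
  have h2 : z i ∈ Set.Ioo (v i - r) (v i + r) := by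
    have := abs_lt.1 (hz i); constructor <;> linarith [this.1, this.2]
  have h3 := convex_Ioo (v i - r) (v i + r) h1 h2 ha hb hab
  simp only [smul_eq_mul, Set.mem_Ioo] at h3
  simp only [PiLp.add_apply, PiLp.smul_apply, smul_eq_mul]
  rw [abs_lt]
  constructor <;> linarith [h3.1, h3.2]

lemma aux_cube_sub (v : V3) (r : ℝ) (hr : 0 < r) : cube v r ⊆ Metric.closedBall v (2 * r) := by
  intro w hw
  rw [mem_closedBall_iff_norm]
  refine (sq_le_sq₀ (norm_nonneg _) (by positivity)).1 ?_
  rw [EuclideanSpace.real_norm_sq_eq]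
  have : ∀ i, ((w - v) i) ^ 2 ≤ r ^ 2 := fun i => by
    rw [PiLp.sub_apply]
    exact sq_le_sq.2 ((hw i).le.trans (le_abs_self r))
  rw [Fin.sum_univ_three]
  nlinarith [this 0, this 1, this 2]

/-- Scale-invariant core estimate. -/
lemma aux_core (g : V3 → ℝ) (hg : ContDiff ℝ 2 g) (hpos : ∀ y, 0 < g y)
    (hh : ContDiff ℝ 2 (fun x => Real.log (g x))) (v : V3) (r c0 c1 Lc δ B α : ℝ)
    (hr : 0 < r) (hδ : 0 < δ) (hδ1 : δ < 1) (hLc : 0 ≤ Lc) (hα : 0 < α) (hαδ : α ≤ δ)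
    (hosc : ∀ y ∈ Metric.closedBall v (5 * r), ∀ y' ∈ Metric.closedBall v (5 * r),
      |Real.log (g y) - Real.log (g y')| ≤ c1)
    (hhol : ∀ i j, ∀ y ∈ Metric.closedBall v (5 * r), ∀ y' ∈ Metric.closedBall v (5 * r),
      |logHess g y i j - logHess g y' i j| ≤ Lc * ‖y - y'‖ ^ δ)
    (hc0 : Lc * r ^ (2 + δ) ≤ c0)
    (hB : ∀ w ∈ cube v r, g w ≤ B) (w z : V3) (hw : w ∈ cube v r) (hz : z ∈ cube v r)
    (i j : Fin 3) :
    r ^ (2 + α) * |hess g w i j - hess g z i j| ≤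
      (12 * (c1 + 3 * (2 * c1 + 2 * c0)) * ((c1 + 3 * (2 * c1 + 2 * c0)) ^ 2 + (2 * c1 + 2 * c0))
        + 24 * (c1 + 3 * (2 * c1 + 2 * c0)) * (2 * c1 + 2 * c0) + 4 * c0) * B * ‖w - z‖ ^ α := by
  set h : V3 → ℝ := fun x => Real.log (g x) with hdef
  set a := 2 * c1 + 2 * c0 with ha
  set b := c1 + 3 * a with hb
  have hH : ∀ y ∈ Metric.closedBall v (3 * r), ∀ i j, |hess h y i j| ≤ a / r ^ 2 := by
    intro y hy i j
    rw [le_div_iff₀ (by positivity), mul_comm]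
    exact aux_hessbound h hh v r c0 c1 Lc δ hr hδ hδ1 hLc hosc hhol hc0 y hy i j
  have hG : ∀ y ∈ Metric.closedBall v (2 * r), ∀ i, |fderiv ℝ h y (esingle i)| ≤ b / r := by
    intro y hy i
    rw [le_div_iff₀ hr, mul_comm]
    have := aux_gradbound h hh v r _ c1 hr hosc hH y hy i
    rwa [mul_div_cancel₀ _ (by positivity)] at this
  have hsub := aux_cube_sub v r hr
  have h23 : Metric.closedBall v (2 * r) ⊆ Metric.closedBall v (3 * r) :=
    Metric.closedBall_subset_closedBall (by linarith)
  have h25 : Metric.closedBall v (2 * r) ⊆ Metric.closedBall v (5 * r) :=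
    Metric.closedBall_subset_closedBall (by linarith)
  have ha0 : 0 ≤ a / r ^ 2 := (abs_nonneg _).trans (hH w (h23 (hsub hw)) 0 0)
  have hb0 : 0 ≤ b / r := (abs_nonneg _).trans (hG w (hsub hw) 0)
  have hB0 : 0 < B := (hpos w).trans_le (hB w hw)
  set D := ‖w - z‖ with hD
  have hD0 : 0 ≤ D := norm_nonneg _
  have hD4 : D ≤ 4 * r := by
    have h1 := mem_closedBall_iff_norm.1 (hsub hw)
    have h2 := mem_closedBall_iff_norm.1 (hsub hz)
    have : w - z = (w - v) - (z - v) := by abel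
    rw [hD, this]
    exact (norm_sub_le _ _).trans (by linarith)
  -- Lipschitz bounds
  have lg : |g w - g z| ≤ 3 * (B * (b / r)) * D := by
    refine aux_lip g (hg.differentiable (by norm_num)) _ (aux_cube_convex v r) _ ?_ w z hw hz
    intro y hy k
    rw [(aux_hessexp g hg hpos hh k k y).1, abs_mul, abs_of_pos (hpos y)]
    exact mul_le_mul (hB y hy) (hG y (hsub hy) k) (abs_nonneg _) hB0.le
  have lP : ∀ k, |fderiv ℝ h w (esingle k) - fderiv ℝ h z (esingle k)| ≤ 3 * (a / r ^ 2) * D := by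
    intro k
    refine aux_lip _ (aux_Pdiff h hh k) _ (convex_closedBall v (2 * r)) _ ?_ w z (hsub hw) (hsub hz)
    intro y hy l
    rw [← aux_hess h hh]
    exact hH y (h23 hy) l k
  have lH : |hess h w i j - hess h z i j| ≤ Lc * D ^ δ :=
    hhol i j w (h25 (hsub hw)) z (h25 (hsub hz))
  rw [(aux_hessexp g hg hpos hh i j w).2, (aux_hessexp g hg hpos hh i j z).2]
  change r ^ (2 + α) * |g w * (fderiv ℝ h w (esingle i) * fderiv ℝ h w (esingle j) + hess h w i j)
    - g z * (fderiv ℝ h z (esingle i) * fderiv ℝ h z (esingle j) + hess h z i j)| ≤ _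
  have gwi := hG w (hsub hw) i
  have gwj := hG w (hsub hw) j
  have gzj := hG z (hsub hz) j
  have hwij := hH w (h23 (hsub hw)) i j
  have lPi := lP i
  have lPj := lP j
  have gz := hB z hz
  have gz0 := hpos z
  generalize fderiv ℝ h w (esingle i) = pwi at *
  generalize fderiv ℝ h w (esingle j) = pwj at *
  generalize fderiv ℝ h z (esingle i) = pzi at *
  generalize fderiv ℝ h z (esingle j) = pzj at *
  generalize hess h w i j = Hw at *
  generalize hess h z i j = Hz at *
  generalize g w = gw at *
  generalize g z = gz' at *
  set G := b / r with hGdef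
  set A := a / r ^ 2 with hAdef
  have k1 : |gw * (pwi * pwj + Hw) - gz' * (pzi * pzj + Hz)| ≤
      3 * (B * G) * D * (G * G + A) + B * (G * (3 * A * D) + 3 * A * D * G + Lc * D ^ δ) := by
    have e : gw * (pwi * pwj + Hw) - gz' * (pzi * pzj + Hz) =
      (gw - gz') * (pwi * pwj + Hw) + gz' * (pwi * (pwj - pzj) + (pwi - pzi) * pzj + (Hw - Hz)) := by
      ring
    rw [e]
    refine (abs_add_le _ _).trans (add_le_add ?_ ?_)
    · rw [abs_mul]
      refine mul_le_mul lg ?_ (abs_nonneg _) (by positivity)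
      refine (abs_add_le _ _).trans (add_le_add ?_ hwij)
      rw [abs_mul]
      exact mul_le_mul gwi gwj (abs_nonneg _) hb0
    · rw [abs_mul, abs_of_pos gz0]
      refine mul_le_mul gz ?_ (abs_nonneg _) hB0.le
      refine (abs_add_three _ _ _).trans (add_le_add (add_le_add ?_ ?_) lH)
      · rw [abs_mul]
        exact mul_le_mul gwi lPj (abs_nonneg _) hb0
      · rw [abs_mul]
        exact mul_le_mul lPi gzj (abs_nonneg _) (by positivity)
  -- powers
  have pw : ∀ q : ℝ, α ≤ q → q ≤ 1 → r ^ (2 + α) * D ^ q ≤ 4 * r ^ (2 + q) * D ^ α := by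
    intro q hq hq1
    rcases hD0.eq_or_lt with h0 | h0
    · rw [← h0, Real.zero_rpow (by linarith), Real.zero_rpow (by linarith)]; simp
    have e1 : D ^ q = D ^ α * D ^ (q - α) := by rw [← Real.rpow_add h0]; ring_nf
    have e2 : r ^ (2 + q) = r ^ (2 + α) * r ^ (q - α) := by rw [← Real.rpow_add hr]; ring_nf
    have e3 : D ^ (q - α) ≤ 4 * r ^ (q - α) := by
      refine (Real.rpow_le_rpow hD0 hD4 (by linarith)).trans ?_
      rw [Real.mul_rpow (by norm_num) hr.le]
      have : (4 : ℝ) ^ (q - α) ≤ 4 := by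
        calc (4 : ℝ) ^ (q - α) ≤ 4 ^ (1 : ℝ) :=
              Real.rpow_le_rpow_of_exponent_le (by norm_num) (by linarith)
          _ = 4 := by norm_num
      gcongr
    rw [e1, e2]
    have : 0 ≤ r ^ (2 + α) * D ^ α := by positivity
    nlinarith [mul_le_mul_of_nonneg_left e3 this]
  have p1 := pw 1 (by linarith) le_rfl
  have p2 := pw δ hαδ hδ1.le
  have e3 : r ^ ((2 : ℝ) + 1) = r ^ 3 := by
    rw [show (2 : ℝ) + 1 = ((3 : ℕ) : ℝ) by norm_num, Real.rpow_natCast]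
  rw [Real.rpow_one, e3] at p1
  have hrα : 0 ≤ r ^ (2 + α) := by positivity
  have hDα : 0 ≤ D ^ α := by positivity
  have hbG : b = G * r := by rw [hGdef]; field_simp
  have haA : a = A * r ^ 2 := by rw [hAdef]; field_simp
  have q0 := mul_le_mul_of_nonneg_left k1 hrα
  have q1 : 0 ≤ B * (3 * G * (G * G + A) + 6 * G * A) := by positivity
  have q2 := mul_le_mul_of_nonneg_left p1 q1
  have q3 := mul_le_mul_of_nonneg_left p2 (mul_nonneg hB0.le hLc)
  have q4 := mul_le_mul_of_nonneg_left hc0 (mul_nonneg hB0.le hDα)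
  refine q0.trans ?_
  rw [hbG, haA]
  have E1 : r ^ (2 + α) * (3 * (B * G) * D * (G * G + A)
      + B * (G * (3 * A * D) + 3 * A * D * G + Lc * D ^ δ))
      = B * (3 * G * (G * G + A) + 6 * G * A) * (r ^ (2 + α) * D)
        + B * Lc * (r ^ (2 + α) * D ^ δ) := by ring
  rw [E1]
  have E2 : (12 * (G * r) * ((G * r) ^ 2 + A * r ^ 2) + 24 * (G * r) * (A * r ^ 2) + 4 * c0) * B * D ^ α
      = B * (3 * G * (G * G + A) + 6 * G * A) * (4 * r ^ 3 * D ^ α) + 4 * (B * D ^ α * c0) := by ring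
  rw [E2]
  linarith

lemma aux_dCube_le (v : V3) (r : ℝ) (w : V3) : dCube v r w ≤ r := by
  unfold dCube
  refine (Finset.inf'_le _ (Finset.mem_univ (0 : Fin 3))).trans ?_
  linarith [abs_nonneg (w 0 - v 0)]

lemma aux_dCube_nonneg (v : V3) (r : ℝ) (w : V3) (hw : w ∈ cube v r) : 0 ≤ dCube v r w := by
  unfold dCube
  refine Finset.le_inf' _ _ fun i _ => ?_
  linarith [hw i]

/-- weighted C^{2+α} bound on the initial datum on the small cube
Σ_r(v), r = (1/2)⟨v⟩^{−β} (Lemma 12 of the paper). -/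
theorem initial_datum_weighted_bound
    (γ : ℝ) (hγ : γ ∈ Set.Icc (-3 : ℝ) (-2))
    (δ : ℝ) (hδ : δ ∈ Set.Ioo (0 : ℝ) 1) (ℓ μ k K Cg : ℝ)
    (hμ : 0 < μ) (hk : 0 < k) (hK : 0 < K) (hCg : 0 < Cg)
    (g₀ : V3 → ℝ) (hg₀int : Integrable g₀) (hg₀mass : (∫ v, g₀ v) = 1)
    (hmax : ∀ v : V3, k * Real.exp (-μ * ‖v‖ ^ 2) ≤ g₀ v ∧
      g₀ v ≤ K * Real.exp (-μ * ‖v‖ ^ 2))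
    (hlogC2 : ContDiff ℝ 2 (fun v => Real.log (g₀ v)))
    (hC2 : ContDiff ℝ 2 g₀)
    (hholder : ∀ R : ℝ, 1 ≤ R → ∀ i j : Fin 3,
      ∀ v ∈ Metric.ball (0 : V3) R, ∀ w ∈ Metric.ball (0 : V3) R,
        |logHess g₀ v i j - logHess g₀ w i j| ≤ Cg * R ^ ℓ * ‖v - w‖ ^ δ) :
    ∃ C : ℝ, 0 < C ∧
      ∀ α ∈ Set.Ioc (0 : ℝ) δ, ∀ v : V3, ∀ B : ℝ,
        (∀ w ∈ cube v ((1 / 2) * jap v ^ (-(max (2 + (ℓ - 2) / (2 + δ)) 1))),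
          g₀ w ≤ B) →
        ∀ w ∈ cube v ((1 / 2) * jap v ^ (-(max (2 + (ℓ - 2) / (2 + δ)) 1))),
        ∀ z ∈ cube v ((1 / 2) * jap v ^ (-(max (2 + (ℓ - 2) / (2 + δ)) 1))),
        ∀ i j : Fin 3,
          min (dCube v ((1 / 2) * jap v ^ (-(max (2 + (ℓ - 2) / (2 + δ)) 1))) w)
                (dCube v ((1 / 2) * jap v ^ (-(max (2 + (ℓ - 2) / (2 + δ)) 1))) z) ^
              (2 + α) *
            |hess g₀ w i j - hess g₀ z i j| ≤
          C * B *
            jap v ^ (-(max (2 + (ℓ - 2) / (2 + δ)) 1 * α) +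
              max (2 + α * (ℓ - 2) / (2 + δ)) (2 - α)) *
            ‖w - z‖ ^ α := by
  obtain ⟨hδ0, hδ1⟩ := hδ
  have hpos : ∀ y, 0 < g₀ y := fun y => (by positivity : 0 < k * Real.exp (-μ * ‖y‖ ^ 2)).trans_le (hmax y).1
  have hlog : ∀ y, Real.log k - μ * ‖y‖ ^ 2 ≤ Real.log (g₀ y) ∧
      Real.log (g₀ y) ≤ Real.log K - μ * ‖y‖ ^ 2 := by
    intro y
    have h1 := Real.log_le_log (by positivity) (hmax y).1
    have h2 := Real.log_le_log (hpos y) (hmax y).2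
    rw [Real.log_mul hk.ne' (Real.exp_pos _).ne', Real.log_exp] at h1
    rw [Real.log_mul hK.ne' (Real.exp_pos _).ne', Real.log_exp] at h2
    constructor <;> linarith
  have hkK : Real.log k ≤ Real.log K := by linarith [(hlog 0).1, (hlog 0).2]
  set c1 := Real.log K - Real.log k + 35 * μ with hc1
  set c0 := Cg * 4 ^ |ℓ| with hc0
  have hc1p : 0 < c1 := by rw [hc1]; linarith
  have hc0p : 0 < c0 := by positivity
  refine ⟨12 * (c1 + 3 * (2 * c1 + 2 * c0)) * ((c1 + 3 * (2 * c1 + 2 * c0)) ^ 2 + (2 * c1 + 2 * c0))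
        + 24 * (c1 + 3 * (2 * c1 + 2 * c0)) * (2 * c1 + 2 * c0) + 4 * c0, by positivity, ?_⟩
  intro α hα v B hB w hw z hz i j
  obtain ⟨hα0, hαδ⟩ := hα
  set β := max (2 + (ℓ - 2) / (2 + δ)) 1 with hβ
  have hβ1 : 1 ≤ β := le_max_right _ _
  have hβ2 : 2 + (ℓ - 2) / (2 + δ) ≤ β := le_max_left _ _
  set x := jap v with hx
  have hx1 : 1 ≤ x := by
    rw [hx, jap]; exact Real.one_le_sqrt.2 (by nlinarith [sq_nonneg ‖v‖])
  have hx0 : 0 < x := by linarith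
  have hvx : ‖v‖ ≤ x := by
    rw [hx, jap]; exact Real.le_sqrt_of_sq_le (by linarith)
  set r := (1 / 2) * x ^ (-β) with hrdef
  have hr : 0 < r := by positivity
  have hxβ : x ^ (-β) ≤ x⁻¹ := by
    rw [← Real.rpow_neg_one]
    exact Real.rpow_le_rpow_of_exponent_le hx1 (by linarith)
  have hrx : r * x ≤ 1 / 2 := by
    have : x ^ (-β) * x ≤ x⁻¹ * x := by gcongr
    rw [inv_mul_cancel₀ hx0.ne'] at this
    rw [hrdef]; linarith
  have hr2 : r ≤ 1 / 2 := by nlinarith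
  have hball : ∀ y ∈ Metric.closedBall v (5 * r), ‖y‖ ≤ ‖v‖ + 5 * r ∧ ‖v‖ - 5 * r ≤ ‖y‖ := by
    intro y hy
    have h1 := mem_closedBall_iff_norm.1 hy
    have h2 := abs_le.1 ((abs_norm_sub_norm_le y v).trans h1)
    constructor <;> linarith [h2.1, h2.2]
  have hosc : ∀ y ∈ Metric.closedBall v (5 * r), ∀ y' ∈ Metric.closedBall v (5 * r),
      Real.log (g₀ y) - Real.log (g₀ y') ≤ c1 := by
    intro y hy y' hy'
    have h1 := hball y hy
    have h2 := hball y' hy'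
    have h3 := (hlog y).2
    have h4 := (hlog y').1
    have h5 : ‖y'‖ ^ 2 - ‖y‖ ^ 2 ≤ 35 := by
      have e1 : ‖y'‖ - ‖y‖ ≤ 10 * r := by linarith [h1.2, h2.1]
      have e2 : ‖y'‖ + ‖y‖ ≤ 7 * x := by linarith [h1.1, h2.1]
      have e3 : (‖y'‖ - ‖y‖) * (‖y'‖ + ‖y‖) ≤ 10 * r * (7 * x) :=
        mul_le_mul e1 e2 (by positivity) (by positivity)
      nlinarith
    have h6 := mul_le_mul_of_nonneg_left h5 hμ.le
    rw [hc1]; nlinarith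
  have hR1 : 1 ≤ x + 3 := by linarith
  have hmem : ∀ y ∈ Metric.closedBall v (5 * r), y ∈ Metric.ball (0 : V3) (x + 3) := by
    intro y hy
    rw [mem_ball_zero_iff]
    linarith [(hball y hy).1]
  have hRl : (x + 3) ^ ℓ ≤ 4 ^ |ℓ| * x ^ ℓ := by
    have e : x + 3 = ((x + 3) / x) * x := by field_simp
    have e1 : 1 ≤ (x + 3) / x := by rw [le_div_iff₀ hx0]; linarith
    have e2 : (x + 3) / x ≤ 4 := by rw [div_le_iff₀ hx0]; linarith
    rw [e, Real.mul_rpow (by positivity) hx0.le]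
    gcongr
    calc ((x + 3) / x) ^ ℓ ≤ ((x + 3) / x) ^ |ℓ| :=
          Real.rpow_le_rpow_of_exponent_le e1 (le_abs_self _)
      _ ≤ 4 ^ |ℓ| := Real.rpow_le_rpow (by positivity) e2 (abs_nonneg _)
  have hexp : ℓ + -β * (2 + δ) ≤ 0 := by
    have := mul_le_mul_of_nonneg_right hβ2 (by linarith : 0 ≤ 2 + δ)
    rw [add_mul, div_mul_cancel₀ _ (by linarith)] at this
    linarith
  have hLr : Cg * (x + 3) ^ ℓ * r ^ (2 + δ) ≤ c0 := by
    have e1 : r ^ (2 + δ) ≤ x ^ (-β * (2 + δ)) := by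
      rw [Real.rpow_mul hx0.le]
      refine Real.rpow_le_rpow hr.le ?_ (by linarith)
      have : 0 < x ^ (-β) := by positivity
      rw [hrdef]; linarith
    calc Cg * (x + 3) ^ ℓ * r ^ (2 + δ) ≤ Cg * (4 ^ |ℓ| * x ^ ℓ) * x ^ (-β * (2 + δ)) := by gcongr
      _ = c0 * x ^ (ℓ + -β * (2 + δ)) := by rw [Real.rpow_add hx0, hc0]; ring
      _ ≤ c0 * 1 := by
          gcongr
          exact Real.rpow_le_one_of_one_le_of_nonpos hx1 hexp
      _ = c0 := mul_one _
  have main := aux_core g₀ hC2 hpos hlogC2 v r c0 c1 (Cg * (x + 3) ^ ℓ) δ B α hr hδ0 hδ1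
    (by positivity) hα0 hαδ
    (fun y hy y' hy' => abs_sub_le_iff.2 ⟨hosc y hy y' hy', hosc y' hy' y hy⟩)
    (fun i j y hy y' hy' => hholder (x + 3) hR1 i j y (hmem y hy) y' (hmem y' hy'))
    hLr hB w z hw hz i j
  have hB0 : 0 < B := (hpos w).trans_le (hB w hw)
  have hmin : min (dCube v r w) (dCube v r z) ^ (2 + α) ≤ r ^ (2 + α) :=
    Real.rpow_le_rpow (le_min (aux_dCube_nonneg v r w hw) (aux_dCube_nonneg v r z hz))
      ((min_le_left _ _).trans (aux_dCube_le v r w)) (by linarith)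
  have hexp2 : 0 ≤ -(β * α) + max (2 + α * (ℓ - 2) / (2 + δ)) (2 - α) := by
    rw [mul_div_assoc]
    rcases max_choice (2 + (ℓ - 2) / (2 + δ)) 1 with h | h
    · have := le_max_left (2 + α * ((ℓ - 2) / (2 + δ))) (2 - α)
      have e : (2 + (ℓ - 2) / (2 + δ)) * α = 2 * α + α * ((ℓ - 2) / (2 + δ)) := by ring
      rw [hβ, h, e]; linarith
    · have := le_max_right (2 + α * ((ℓ - 2) / (2 + δ))) (2 - α)
      rw [hβ, h]; linarith
  have hone := Real.one_le_rpow hx1 hexp2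
  refine (mul_le_mul_of_nonneg_right hmin (abs_nonneg _)).trans (main.trans ?_)
  refine mul_le_mul_of_nonneg_right ?_ (by positivity)
  exact le_mul_of_one_le_right (by positivity) hone

end
end

section
/- (Schauder estimate for frozen coefficients) Let R > 0, T > 0 and Q = [0,T] × (−R,R)³. Let b : [0,T] → symmetric 3×3 matrices satisfy, for constants 0 < ω ≤ Ω, ω|ξ|² ≤ ⟨b(t)ξ, ξ⟩ ≤ Ω|ξ|² for all t ∈ [0,T] and ξ ∈ ℝ³, and set L = Σ_{i,j} b_{ij}(t) ∂_{ij}. Let u : Q̄ → ℝ be C¹ in time and C² in velocity up to the boundary, and u₀ = u(0,·). Then for every α ∈ (0,1) there exists C_α depending only on α such that, for all t ∈ [0,T], all i, j, k ∈ {1,2,3} and all h ∈ (0,R]: |∂_{ij}u(t, h e_k) − ∂_{ij}u(t, −h e_k)| / (2h)^α ≤ C_α ( [u₀]_{2+α,(−R,R)³} + ω^{−1} [∂_t u − Lu]_{α,Q} + R^{−α}(1 + ω^{−1}Ω) ‖∇²u‖_{L^∞(Q)} ), where (e_k) is the canonical basis of ℝ³. -/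
noncomputable section

open MeasureTheory Real
open scoped ENNReal RealInnerProductSpace

open Filter Topology Set

/-- symmetric difference operator -/
def DD (d : V3) (y : ℝ) (f : V3 → ℝ) : V3 → ℝ := fun x => f (x + y • d) - f (x - y • d)

/-- Hessian via iterated fderiv -/
def hessM (f : V3 → ℝ) (v : V3) : Mat3 := fun i j =>
  fderiv ℝ (fderiv ℝ f) v (esingle i) (esingle j)

lemma DD_comm (d d' : V3) (y y' : ℝ) (f : V3 → ℝ) :
    DD d y (DD d' y' f) = DD d' y' (DD d y f) := by
  funext x
  simp only [DD]
  rw [add_right_comm x (y • d), sub_add_eq_add_sub x (y • d), add_sub_right_comm x (y • d) (y' • d'),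
    sub_right_comm x (y • d)]
  ring

lemma DD_shift (d : V3) (y s : ℝ) (f : V3 → ℝ) (x : V3) :
    DD d (y + s) f x + DD d (y - s) f x = DD d y f (x + s • d) + DD d y f (x - s • d) := by
  simp only [DD]
  have e1 : x + (y + s) • d = x + s • d + y • d := by module
  have e2 : x - (y + s) • d = x - s • d - y • d := by module
  have e3 : x + (y - s) • d = x - s • d + y • d := by module
  have e4 : x - (y - s) • d = x + s • d - y • d := by module
  rw [e1, e2, e3, e4]; ring

lemma DD_shift2 (d d' : V3) (y y' s : ℝ) (f : V3 → ℝ) (x : V3) :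
    DD d' y' (DD d (y + s) f) x + DD d' y' (DD d (y - s) f) x
      = DD d' y' (DD d y f) (x + s • d) + DD d' y' (DD d y f) (x - s • d) := by
  rw [DD_comm d', DD_comm d', DD_comm d']
  exact DD_shift d y s _ x

lemma DD_shift3 (d d' d'' : V3) (y y' y'' s : ℝ) (f : V3 → ℝ) (x : V3) :
    DD d'' y'' (DD d' y' (DD d (y + s) f)) x + DD d'' y'' (DD d' y' (DD d (y - s) f)) x
      = DD d'' y'' (DD d' y' (DD d y f)) (x + s • d)
        + DD d'' y'' (DD d' y' (DD d y f)) (x - s • d) := by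
  rw [DD_comm d' d, DD_comm d' d, DD_comm d' d]
  exact DD_shift2 d d'' y y'' s _ x

/-- one dimensional second difference limit -/
lemma sd_lim_1d (f f' : ℝ → ℝ) (c : ℝ) (h1 : ∀ᶠ s in 𝓝 0, HasDerivAt f (f' s) s)
    (h2 : HasDerivAt f' c 0) :
    Tendsto (fun s => (f s + f (-s) - 2 * f 0) / s ^ 2) (𝓝[≠] 0) (𝓝 c) := by
  have h1n : ∀ᶠ s in 𝓝 (0:ℝ), HasDerivAt f (f' (-s)) (-s) := by
    have : Tendsto (fun s : ℝ => -s) (𝓝 0) (𝓝 0) := by simpa using (continuous_neg (G := ℝ)).tendsto 0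
    exact this.eventually h1
  have hc0 : ContinuousAt f 0 := h1.self_of_nhds.continuousAt
  refine HasDerivAt.lhopital_zero_nhdsNE (f' := fun s => f' s - f' (-s)) (g' := fun s => 2 * s)
    ?_ ?_ ?_ ?_ ?_ ?_
  · filter_upwards [h1.filter_mono nhdsWithin_le_nhds, h1n.filter_mono nhdsWithin_le_nhds]
      with s ha hb
    have hb' : HasDerivAt (fun s => f (-s)) (-(f' (-s))) s := by
      have := hb.comp s (hasDerivAt_neg s)
      simpa [Function.comp_def] using this
    simpa [sub_eq_add_neg] using (ha.add hb').sub_const (2 * f 0)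
  · filter_upwards with s
    simpa using hasDerivAt_pow 2 s
  · filter_upwards [self_mem_nhdsWithin] with s hs
    simpa using hs
  · have hn : ContinuousAt (fun s => f (-s)) 0 := by
      apply ContinuousAt.comp (by simpa using hc0) continuous_neg.continuousAt
    have : ContinuousAt (fun s => f s + f (-s) - 2 * f 0) 0 :=
      (hc0.add hn).sub continuousAt_const
    have h := this.tendsto
    have e : f 0 + f (-0) - 2 * f 0 = 0 := by simp; ring
    rw [e] at h
    exact h.mono_left nhdsWithin_le_nhds
  · have : ContinuousAt (fun s : ℝ => s ^ 2) 0 := by fun_prop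
    have h := this.tendsto
    simp only [ne_eq, OfNat.ofNat_ne_zero, not_false_eq_true, zero_pow] at h
    exact h.mono_left nhdsWithin_le_nhds
  · have hn : HasDerivAt (fun s => f' (-s)) (-c) 0 := by
      have h2' : HasDerivAt f' c (-0) := by simpa using h2
      have := h2'.comp 0 (hasDerivAt_neg 0)
      simpa [Function.comp_def] using this
    have h := (h2.sub hn)
    have h := hasDerivAt_iff_tendsto_slope.1 h
    have h := h.const_mul (1/2)
    have e : 1/2 * (c - -c) = c := by ring
    rw [e] at h
    refine h.congr' ?_
    filter_upwards [self_mem_nhdsWithin] with s hs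
    have hs : s ≠ 0 := hs
    simp [slope_def_field]
    field_simp

/-- second symmetric difference limit predicate -/
def SD (f : V3 → ℝ) (p ξ : V3) (L : ℝ) : Prop :=
  Tendsto (fun s : ℝ => (f (p + s • ξ) + f (p - s • ξ) - 2 * f p) / s ^ 2) (𝓝[≠] 0) (𝓝 L)

lemma SD_of_contDiffAt (f : V3 → ℝ) (p ξ : V3) (hf : ContDiffAt ℝ 2 f p) :
    SD f p ξ (fderiv ℝ (fderiv ℝ f) p ξ ξ) := by
  have hd : ∀ᶠ q in 𝓝 p, DifferentiableAt ℝ f q := by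
    have := hf.eventually (by simp)
    filter_upwards [this] with q hq
    exact hq.differentiableAt (by norm_num)
  have hline : ∀ s : ℝ, HasDerivAt (fun s : ℝ => p + s • ξ) ξ s := by
    intro s
    simpa using ((hasDerivAt_id s).smul_const ξ).const_add p
  have ht : Tendsto (fun s : ℝ => p + s • ξ) (𝓝 0) (𝓝 p) := by
    have := (hline 0).continuousAt.tendsto
    simpa using this
  have hdd : DifferentiableAt ℝ (fderiv ℝ f) p :=
    (hf.fderiv_right (m := 1) (by norm_num)).differentiableAt (by norm_num)
  have := sd_lim_1d (fun s => f (p + s • ξ)) (fun s => fderiv ℝ f (p + s • ξ) ξ)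
    (fderiv ℝ (fderiv ℝ f) p ξ ξ) ?_ ?_
  · simpa [SD, sub_eq_add_neg] using this
  · filter_upwards [ht.eventually hd] with s hs
    exact hs.hasFDerivAt.comp_hasDerivAt s (hline s)
  · have h0 : p = p + (0:ℝ) • ξ := by simp
    have hdd' : HasFDerivAt (fderiv ℝ f) (fderiv ℝ (fderiv ℝ f) p) (p + (0:ℝ) • ξ) := by
      rw [← h0]; exact hdd.hasFDerivAt
    have h := hdd'.comp_hasDerivAt (0:ℝ) (hline 0)
    have h2 := h.clm_apply (hasDerivAt_const (0:ℝ) ξ)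
    simpa using h2

lemma SD_DD {f g : V3 → ℝ} {d p ξ : V3} {y : ℝ}
    (h1 : SD f (p + y • d) ξ (g (p + y • d))) (h2 : SD f (p - y • d) ξ (g (p - y • d))) :
    SD (DD d y f) p ξ (DD d y g p) := by
  have := Tendsto.sub h1 h2
  refine this.congr ?_
  intro s
  simp only [DD]
  rw [add_right_comm p (y • d), sub_add_eq_add_sub p (y • d), add_sub_right_comm p (y • d) (s • ξ),
    sub_right_comm p (y • d)]
  ring

lemma rpow_sd (β y : ℝ) (hy : 0 < y) :
    Tendsto (fun s : ℝ => ((y + s) ^ β + (y - s) ^ β - 2 * y ^ β) / s ^ 2) (𝓝[≠] 0)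
      (𝓝 (β * (β - 1) * y ^ (β - 2))) := by
  have := sd_lim_1d (fun s => (y + s) ^ β) (fun s => β * (y + s) ^ (β - 1))
    (β * (β - 1) * y ^ (β - 2)) ?_ ?_
  · simpa [sub_eq_add_neg] using this
  · have : ∀ᶠ s in 𝓝 (0:ℝ), -y < s := lt_mem_nhds (by linarith)
    filter_upwards [this] with s hs
    have h := ((hasDerivAt_id s).const_add y).rpow_const (p := β) (Or.inl (by simp; linarith))
    simpa using h
  · have h := (((hasDerivAt_id (0:ℝ)).const_add y).rpow_const (p := β - 1)
      (Or.inl (by simp; linarith))).const_mul β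
    have e : β - 1 - 1 = β - 2 := by ring
    simpa [e, mul_assoc] using h

/-- mixed difference bound for functions of two real variables -/
lemma mixed_bound (w w1 w2 : ℝ → ℝ → ℝ) (yb yc c B : ℝ) (hb : 0 ≤ yb) (hc : 0 ≤ yc)
    (h1 : ∀ s ∈ Icc (-yb) yb, ∀ r ∈ Icc (-yc) yc, HasDerivAt (fun s => w s r) (w1 s r) s)
    (h2 : ∀ s ∈ Icc (-yb) yb, ∀ r ∈ Icc (-yc) yc, HasDerivAt (fun r => w1 s r) (w2 s r) r)
    (hB : ∀ s ∈ Icc (-yb) yb, ∀ r ∈ Icc (-yc) yc, |w2 s r - c| ≤ B) :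
    |w yb yc - w yb (-yc) - w (-yb) yc + w (-yb) (-yc) - 4 * yb * yc * c| ≤ 4 * yb * yc * B := by
  have hB' : ∀ s ∈ Icc (-yb) yb, |w1 s yc - w1 s (-yc) - 2 * yc * c| ≤ 2 * yc * B := by
    intro s hs
    have := Convex.norm_image_sub_le_of_norm_hasDerivWithin_le (f := fun r => w1 s r - r * c)
      (f' := fun r => w2 s r - c) (C := B) (s := Icc (-yc) yc) (x := -yc) (y := yc)
      (fun r hr => by
        have := ((h2 s hs r hr).fun_sub ((hasDerivAt_id r).mul_const c)).hasDerivWithinAt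
          (s := Icc (-yc) yc)
        simpa using this) (fun r hr => hB s hs r hr) (convex_Icc _ _)
      ⟨le_rfl, by linarith⟩ ⟨by linarith, le_rfl⟩
    rw [Real.norm_eq_abs, Real.norm_eq_abs, abs_of_nonneg (by linarith : 0 ≤ yc - -yc)] at this
    convert this using 1
    · congr 1; ring
    · ring
  have := Convex.norm_image_sub_le_of_norm_hasDerivWithin_le
    (f := fun s => w s yc - w s (-yc) - s * (2 * yc * c))
    (f' := fun s => w1 s yc - w1 s (-yc) - 2 * yc * c) (C := 2 * yc * B) (s := Icc (-yb) yb)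
    (x := -yb) (y := yb)
    (fun s hs => by
      have := (((h1 s hs yc ⟨by linarith, le_rfl⟩).fun_sub (h1 s hs (-yc) ⟨le_rfl, by linarith⟩)).fun_sub
        ((hasDerivAt_id s).mul_const (2 * yc * c))).hasDerivWithinAt (s := Icc (-yb) yb)
      simpa using this) (fun s hs => hB' s hs) (convex_Icc _ _)
      ⟨le_rfl, by linarith⟩ ⟨by linarith, le_rfl⟩
  rw [Real.norm_eq_abs, Real.norm_eq_abs, abs_of_nonneg (by linarith : 0 ≤ yb - -yb)] at this
  convert this using 1
  · congr 1; ring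
  · ring

lemma cube_open (R : ℝ) : IsOpen (cube 0 R) := by
  have : cube 0 R = ⋂ i : Fin 3, {v : V3 | |v i - (0:V3) i| < R} := by
    ext v; simp [cube]
  rw [this]
  refine isOpen_iInter_of_finite fun i => ?_
  exact isOpen_lt (by fun_prop) continuous_const

lemma mem_cube0 {R : ℝ} {v : V3} : v ∈ cube 0 R ↔ ∀ i, |v i| < R := by simp [cube]

lemma cube_convex (R : ℝ) : Convex ℝ (cube 0 R) := by
  intro v hv w hw a b ha hb hab
  rw [mem_cube0] at *
  intro i
  have h1 := abs_lt.1 (hv i)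
  have h2 := abs_lt.1 (hw i)
  simp only [PiLp.add_apply, PiLp.smul_apply, smul_eq_mul]
  have hb' : b = 1 - a := by linarith
  subst hb'
  rcases ha.eq_or_lt with h | h
  · subst h; simpa using hw i
  · rw [abs_lt]; constructor <;> nlinarith

lemma cube_sub (R : ℝ) : cube 0 R ⊆ ccube R := fun _ hv i => (mem_cube0.1 hv i).le

lemma hessW_eq (f : V3 → ℝ) (R : ℝ) (v : V3) (hv : v ∈ cube 0 R) :
    hessW f (ccube R) v = hessM f v := by
  funext i j
  have hn : ccube R ∈ 𝓝 v := mem_of_superset ((cube_open R).mem_nhds hv) (cube_sub R)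
  simp only [hessW, hessM]
  have h1 : iteratedFDerivWithin ℝ 2 f (ccube R) v = iteratedFDeriv ℝ 2 f v := by
    rw [← iteratedFDerivWithin_univ]
    apply iteratedFDerivWithin_congr_set
    rw [eventuallyEq_univ]; exact hn
  rw [h1, iteratedFDeriv_two_apply]
  simp

lemma vec_expand (v : V3) : v = ∑ i, v i • esingle i := by
  ext k
  fin_cases k <;> simp [esingle, Fin.sum_univ_three]

lemma quad_eq (f : V3 → ℝ) (v ξ : V3) :
    fderiv ℝ (fderiv ℝ f) v ξ ξ = quadForm (hessM f v) ξ := by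
  conv_lhs => rw [vec_expand ξ]
  simp only [quadForm, bilin, hessM, Fin.sum_univ_three, map_add, map_smul,
    add_apply, smul_apply, smul_eq_mul]
  ring

lemma matDot_le (A G : Mat3) (hA : A.IsSymm) (hp : ∀ ξ : V3, 0 ≤ quadForm A ξ) (c : ℝ)
    (hG : ∀ ξ : V3, quadForm G ξ ≤ c * ‖ξ‖ ^ 2) : matDot A G ≤ c * ∑ i, A i i := by
  have hps : A.PosSemidef := by
    refine Matrix.PosSemidef.of_dotProduct_mulVec_nonneg ?_ ?_
    · simpa [Matrix.IsHermitian, Matrix.conjTranspose_eq_transpose_of_trivial] using hA.eq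
    · intro x
      have := hp (WithLp.toLp 2 x)
      simp only [quadForm, bilin, Fin.sum_univ_three] at this
      simp only [star_trivial, dotProduct, Matrix.mulVec, Fin.sum_univ_three]
      refine this.trans_eq ?_
      ring
  obtain ⟨B, hB⟩ : ∃ B : Mat3, A = B.conjTranspose * B := by
    open scoped MatrixOrder in
    exact CStarAlgebra.nonneg_iff_eq_star_mul_self.1 hps.nonneg
  have hAij : ∀ i j, A i j = ∑ m, B m i * B m j := by
    intro i j; rw [hB]; simp [Matrix.mul_apply]
  have h := fun m => hG (WithLp.toLp 2 (B m))
  have h' : ∑ m, quadForm G (WithLp.toLp 2 (B m)) ≤ ∑ m, c * ‖(WithLp.toLp 2 (B m) : V3)‖ ^ 2 :=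
    Finset.sum_le_sum fun m _ => h m
  simp only [EuclideanSpace.norm_sq_eq, Real.norm_eq_abs, sq_abs] at h'
  simp only [matDot, hAij]
  simp only [quadForm, bilin, Fin.sum_univ_three] at h' ⊢
  linarith

lemma esingle_norm (a : Fin 3) : ‖esingle a‖ = 1 := by simp [esingle]

lemma esingle_abs_le (a i : Fin 3) : |esingle a i| ≤ 1 := by
  fin_cases a <;> fin_cases i <;> simp [esingle]

lemma shift_mem {R r y s : ℝ} {x : V3} (a : Fin 3) (hx : x ∈ cube 0 r) (hs : |s| ≤ y)
    (h : r + y ≤ R) : x + s • esingle a ∈ cube 0 R := by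
  rw [mem_cube0] at *
  intro i
  simp only [PiLp.add_apply, PiLp.smul_apply, smul_eq_mul]
  have h1 := abs_add_le (x i) (s * esingle a i)
  have h2 : |s * esingle a i| ≤ y := by
    rw [abs_mul]
    calc |s| * |esingle a i| ≤ |s| * 1 := by gcongr; exact esingle_abs_le a i
      _ ≤ y := by linarith
  linarith [hx i]

lemma shift_mem' {R r y s : ℝ} {x : V3} (a : Fin 3) (hx : x ∈ cube 0 r) (hs : |s| ≤ y)
    (h : r + y ≤ R) : x - s • esingle a ∈ cube 0 R := by
  have := shift_mem (s := -s) a hx (by rwa [abs_neg]) h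
  simpa [sub_eq_add_neg] using this

lemma line_deriv {U : Set V3} (hU : IsOpen U) {f : V3 → ℝ} (hf : ContDiffOn ℝ 2 f U)
    {x d d' : V3} {s r : ℝ} (hm : x + s • d + r • d' ∈ U) :
    HasDerivAt (fun s : ℝ => f (x + s • d + r • d')) (fderiv ℝ f (x + s • d + r • d') d) s ∧
    HasDerivAt (fun r : ℝ => fderiv ℝ f (x + s • d + r • d') d)
      (fderiv ℝ (fderiv ℝ f) (x + s • d + r • d') d' d) r := by
  have hc : ContDiffAt ℝ 2 f (x + s • d + r • d') := hf.contDiffAt (hU.mem_nhds hm)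
  have hd : HasFDerivAt f _ (x + s • d + r • d') := (hc.differentiableAt (by norm_num)).hasFDerivAt
  have hdd : HasFDerivAt (fderiv ℝ f) (fderiv ℝ (fderiv ℝ f) (x + s • d + r • d')) (x + s • d + r • d') :=
    ((hc.fderiv_right (m := 1) (by norm_num)).differentiableAt (by norm_num)).hasFDerivAt
  constructor
  · have hl : HasDerivAt (fun s : ℝ => x + s • d + r • d') d s := by
      simpa using (((hasDerivAt_id s).smul_const d).const_add x).add_const (r • d')
    exact hd.comp_hasDerivAt s hl
  · have hl : HasDerivAt (fun r : ℝ => x + s • d + r • d') d' r := by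
      simpa using ((hasDerivAt_id r).smul_const d').const_add (x + s • d)
    have h1 := hdd.comp_hasDerivAt r hl
    have h := h1.clm_apply (hasDerivAt_const r d)
    simpa using h

lemma dd2_bound {R r yb yc c B : ℝ} {f : V3 → ℝ} (hf : ContDiffOn ℝ 2 f (cube 0 R)) {x : V3}
    (hx : x ∈ cube 0 r) (hb : 0 ≤ yb) (hc : 0 ≤ yc) (hr : r + yb + yc ≤ R) (b c' : Fin 3)
    (hB : ∀ s ∈ Icc (-yb) yb, ∀ q ∈ Icc (-yc) yc,
      |hessM f (x + s • esingle b + q • esingle c') c' b - c| ≤ B) :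
    |DD (esingle b) yb (DD (esingle c') yc f) x - 4 * yb * yc * c| ≤ 4 * yb * yc * B := by
  have hm : ∀ s ∈ Icc (-yb) yb, ∀ q ∈ Icc (-yc) yc,
      x + s • esingle b + q • esingle c' ∈ cube 0 R := fun s hs q hq =>
    shift_mem c' (shift_mem b hx (abs_le.2 hs) le_rfl) (abs_le.2 hq) hr
  have k := fun s hs q hq => line_deriv (cube_open R) hf (hm s hs q hq)
  have := mixed_bound (fun s q => f (x + s • esingle b + q • esingle c'))
    (fun s q => fderiv ℝ f (x + s • esingle b + q • esingle c') (esingle b))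
    (fun s q => fderiv ℝ (fderiv ℝ f) (x + s • esingle b + q • esingle c') (esingle c') (esingle b))
    yb yc c B hb hc (fun s hs q hq => (k s hs q hq).1) (fun s hs q hq => (k s hs q hq).2) hB
  convert this using 2
  simp only [DD, neg_smul, sub_eq_add_neg]
  ring

lemma dd3_bound {R r ya yb yc B : ℝ} {f : V3 → ℝ} (hf : ContDiffOn ℝ 2 f (cube 0 R)) {x : V3}
    (hx : x ∈ cube 0 r) (ha : 0 ≤ ya) (hb : 0 ≤ yb) (hc : 0 ≤ yc) (hr : r + ya + yb + yc ≤ R)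
    (a b c : Fin 3)
    (hB : ∀ v ∈ cube 0 R, ∀ w ∈ cube 0 R, ‖v - w‖ = 2 * ya →
      |hessM f v c b - hessM f w c b| ≤ B) :
    |DD (esingle a) ya (DD (esingle b) yb (DD (esingle c) yc f)) x| ≤ 4 * yb * yc * B := by
  have hp : x + ya • esingle a ∈ cube 0 (r + ya) := shift_mem a hx (abs_of_nonneg ha).le le_rfl
  have hn : x - ya • esingle a ∈ cube 0 (r + ya) := shift_mem' a hx (abs_of_nonneg ha).le le_rfl
  have hm : ∀ z ∈ cube 0 (r + ya), ∀ s ∈ Icc (-yb) yb, ∀ q ∈ Icc (-yc) yc,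
      z + s • esingle b + q • esingle c ∈ cube 0 R := fun z hz s hs q hq =>
    shift_mem c (shift_mem b hz (abs_le.2 hs) le_rfl) (abs_le.2 hq) hr
  have := mixed_bound (fun s q => f (x + ya • esingle a + s • esingle b + q • esingle c)
      - f (x - ya • esingle a + s • esingle b + q • esingle c))
    (fun s q => fderiv ℝ f (x + ya • esingle a + s • esingle b + q • esingle c) (esingle b)
      - fderiv ℝ f (x - ya • esingle a + s • esingle b + q • esingle c) (esingle b))
    (fun s q => hessM f (x + ya • esingle a + s • esingle b + q • esingle c) c b
      - hessM f (x - ya • esingle a + s • esingle b + q • esingle c) c b) yb yc 0 B hb hc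
    (fun s hs q hq => (line_deriv (cube_open R) hf (hm _ hp s hs q hq)).1.fun_sub
      (line_deriv (cube_open R) hf (hm _ hn s hs q hq)).1)
    (fun s hs q hq => (line_deriv (cube_open R) hf (hm _ hp s hs q hq)).2.fun_sub
      (line_deriv (cube_open R) hf (hm _ hn s hs q hq)).2)
    (fun s hs q hq => by
      rw [sub_zero]
      refine hB _ (hm _ hp s hs q hq) _ (hm _ hn s hs q hq) ?_
      have e : x + ya • esingle a + s • esingle b + q • esingle c -
        (x - ya • esingle a + s • esingle b + q • esingle c) = (2 * ya) • esingle a := by module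
      rw [e, norm_smul, esingle_norm, mul_one, Real.norm_eq_abs, abs_of_nonneg (by linarith)])
  convert this using 2
  simp only [DD, neg_smul, sub_eq_add_neg]
  ring

lemma d3_bound {R r ya yb yc B : ℝ} {g : V3 → ℝ} {x : V3}
    (hx : x ∈ cube 0 r) (ha : 0 ≤ ya) (hb : 0 ≤ yb) (hc : 0 ≤ yc) (hr : r + ya + yb + yc ≤ R)
    (a b c : Fin 3)
    (hB : ∀ v ∈ cube 0 R, ∀ w ∈ cube 0 R, ‖v - w‖ = 2 * ya → |g v - g w| ≤ B) :
    |DD (esingle a) ya (DD (esingle b) yb (DD (esingle c) yc g)) x| ≤ 4 * B := by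
  have hp : x + ya • esingle a ∈ cube 0 (r + ya) := shift_mem a hx (abs_of_nonneg ha).le le_rfl
  have hn : x - ya • esingle a ∈ cube 0 (r + ya) := shift_mem' a hx (abs_of_nonneg ha).le le_rfl
  have hm : ∀ z ∈ cube 0 (r + ya), ∀ s ∈ Icc (-yb) yb, ∀ q ∈ Icc (-yc) yc,
      z + s • esingle b + q • esingle c ∈ cube 0 R := fun z hz s hs q hq =>
    shift_mem c (shift_mem b hz (abs_le.2 hs) le_rfl) (abs_le.2 hq) hr
  have key : ∀ s ∈ Icc (-yb) yb, ∀ q ∈ Icc (-yc) yc,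
      |g (x + ya • esingle a + s • esingle b + q • esingle c)
      - g (x - ya • esingle a + s • esingle b + q • esingle c)| ≤ B := by
    intro s hs q hq
    refine hB _ (hm _ hp s hs q hq) _ (hm _ hn s hs q hq) ?_
    have e : x + ya • esingle a + s • esingle b + q • esingle c -
      (x - ya • esingle a + s • esingle b + q • esingle c) = (2 * ya) • esingle a := by module
    rw [e, norm_smul, esingle_norm, mul_one, Real.norm_eq_abs, abs_of_nonneg (by linarith)]
  have hb1 : yb ∈ Icc (-yb) yb := ⟨by linarith, le_rfl⟩
  have hb2 : -yb ∈ Icc (-yb) yb := ⟨le_rfl, by linarith⟩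
  have hc1 : yc ∈ Icc (-yc) yc := ⟨by linarith, le_rfl⟩
  have hc2 : -yc ∈ Icc (-yc) yc := ⟨le_rfl, by linarith⟩
  have k1 := abs_le.1 (key _ hb1 _ hc1)
  have k2 := abs_le.1 (key _ hb1 _ hc2)
  have k3 := abs_le.1 (key _ hb2 _ hc1)
  have k4 := abs_le.1 (key _ hb2 _ hc2)
  simp only [DD, neg_smul, sub_eq_add_neg] at k1 k2 k3 k4 ⊢
  rw [abs_le]
  constructor <;> linarith [k1.1, k1.2, k2.1, k2.2, k3.1, k3.2, k4.1, k4.2]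

lemma SD3 {R r ya yb yc : ℝ} {f : V3 → ℝ} (hf : ContDiffOn ℝ 2 f (cube 0 R)) {x : V3}
    (hx : x ∈ cube 0 r) (ha : 0 ≤ ya) (hb : 0 ≤ yb) (hc : 0 ≤ yc) (hr : r + ya + yb + yc ≤ R)
    (a b c : Fin 3) (ξ : V3) :
    SD (DD (esingle a) ya (DD (esingle b) yb (DD (esingle c) yc f))) x ξ
      (DD (esingle a) ya (DD (esingle b) yb (DD (esingle c) yc
        (fun p => quadForm (hessM f p) ξ))) x) := by
  have hbase : ∀ p ∈ cube 0 R, SD f p ξ (quadForm (hessM f p) ξ) := by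
    intro p hp
    rw [← quad_eq]
    exact SD_of_contDiffAt f p ξ (hf.contDiffAt ((cube_open R).mem_nhds hp))
  have ha' := (abs_of_nonneg ha).le
  have hb' := (abs_of_nonneg hb).le
  have hc' := (abs_of_nonneg hc).le
  have h1 : ∀ p ∈ cube 0 (r + ya + yb), SD (DD (esingle c) yc f) p ξ
      (DD (esingle c) yc (fun p => quadForm (hessM f p) ξ) p) := fun p hp =>
    SD_DD (hbase _ (shift_mem c hp hc' hr)) (hbase _ (shift_mem' c hp hc' hr))
  have h2 : ∀ p ∈ cube 0 (r + ya), SD (DD (esingle b) yb (DD (esingle c) yc f)) p ξ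
      (DD (esingle b) yb (DD (esingle c) yc (fun p => quadForm (hessM f p) ξ)) p) := fun p hp =>
    SD_DD (h1 _ (shift_mem b hp hb' le_rfl)) (h1 _ (shift_mem' b hp hb' le_rfl))
  exact SD_DD (h2 _ (shift_mem a hx ha' le_rfl)) (h2 _ (shift_mem' a hx ha' le_rfl))

lemma D3_quad (a b c : V3) (ya yb yc : ℝ) (H : V3 → Mat3) (x ξ : V3) :
    DD a ya (DD b yb (DD c yc (fun p => quadForm (H p) ξ))) x
      = quadForm (fun i j => DD a ya (DD b yb (DD c yc (fun p => H p i j))) x) ξ := by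
  simp only [DD, quadForm, bilin, Fin.sum_univ_three]; ring

lemma D3_dot (a b c : V3) (ya yb yc : ℝ) (H : V3 → Mat3) (B : Mat3) (x : V3) (g : V3 → ℝ) :
    DD a ya (DD b yb (DD c yc (fun p => g p - matDot B (H p)))) x
      = DD a ya (DD b yb (DD c yc g)) x -
        matDot B (fun i j => DD a ya (DD b yb (DD c yc (fun p => H p i j))) x) := by
  simp only [DD, matDot, Fin.sum_univ_three]; ring

/-- product of powers -/
def PP (β y1 y2 y3 : ℝ) : ℝ := y1 ^ β * y2 ^ β * y3 ^ β

lemma PP_nonneg {β y1 y2 y3 : ℝ} (h1 : 0 ≤ y1) (h2 : 0 ≤ y2) (h3 : 0 ≤ y3) :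
    0 ≤ PP β y1 y2 y3 := by unfold PP; positivity

lemma exists_gm {y1 y2 y3 : ℝ} (h1 : 0 < y1) (h2 : 0 < y2) (h3 : 0 < y3) :
    ∃ q : ℝ, 0 < q ∧ q ^ 3 = y1 * y2 * y3 ∧ (∀ β, PP β y1 y2 y3 = q ^ (3 * β)) ∧
      (q ≤ y1 ∨ q ≤ y2 ∨ q ≤ y3) ∧ (y1 ≤ q ∨ y2 ≤ q ∨ y3 ≤ q) := by
  have hP : 0 < y1 * y2 * y3 := by positivity
  have hq : 0 < (y1 * y2 * y3) ^ (1/3 : ℝ) := by positivity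
  have hq3 : ((y1 * y2 * y3) ^ (1/3 : ℝ)) ^ 3 = y1 * y2 * y3 := by
    rw [← Real.rpow_natCast, ← Real.rpow_mul hP.le]; norm_num
  refine ⟨(y1 * y2 * y3) ^ (1/3 : ℝ), hq, hq3, ?_, ?_, ?_⟩
  · intro β
    rw [← Real.rpow_mul hP.le, PP, ← Real.mul_rpow h1.le h2.le, ← Real.mul_rpow (by positivity) h3.le]
    congr 1; ring
  · generalize (y1 * y2 * y3) ^ (1/3 : ℝ) = q at *
    by_contra! h
    have : y1 * y2 * y3 < q * q * q := by
      gcongr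
      · exact h.1
      · exact h.2.1
      · exact h.2.2
    nlinarith
  · generalize (y1 * y2 * y3) ^ (1/3 : ℝ) = q at *
    by_contra! h
    have : q * q * q < y1 * y2 * y3 := by
      gcongr
      · exact h.1
      · exact h.2.1
      · exact h.2.2
    nlinarith

lemma rl_aux {α q y p : ℝ} (ha1 : α < 1) (hq : 0 < q) (hqy : q ≤ y)
    (h : q ^ 3 = y * p) : y ^ α * p ≤ q ^ (2 + α) := by
  have hy : 0 < y := hq.trans_le hqy
  have e : y ^ α * p = q ^ 3 * y ^ (α - 1) := by
    rw [Real.rpow_sub_one hy.ne', h]; field_simp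
  have e2 : q ^ (2 + α) = q ^ 3 * q ^ (α - 1) := by
    rw [← Real.rpow_natCast, ← Real.rpow_add hq]; congr 1; push_cast; ring
  rw [e, e2]
  gcongr ?_ * ?_
  exact Real.rpow_le_rpow_of_nonpos hq hqy (by linarith)

lemma rl0 {α Φ N y1 y2 y3 : ℝ} (ha1 : α < 1) (h1 : 0 < y1) (h2 : 0 < y2) (h3 : 0 < y3)
    (hN : 0 ≤ N) (e1 : Φ ≤ N * (y1 ^ α * (y2 * y3))) (e2 : Φ ≤ N * (y2 ^ α * (y1 * y3)))
    (e3 : Φ ≤ N * (y3 ^ α * (y1 * y2))) : Φ ≤ N * PP ((2 + α) / 3) y1 y2 y3 := by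
  obtain ⟨q, hq, hq3, hPP, hge, -⟩ := exists_gm h1 h2 h3
  have e : 3 * ((2 + α) / 3) = 2 + α := by ring
  rw [hPP, e]
  rcases hge with h | h | h
  · exact e1.trans (by gcongr; exact rl_aux ha1 hq h (by rw [hq3]; ring))
  · exact e2.trans (by gcongr; exact rl_aux ha1 hq h (by rw [hq3]; ring))
  · exact e3.trans (by gcongr; exact rl_aux ha1 hq h (by rw [hq3]; ring))

lemma rl2 {Φ N y1 y2 y3 : ℝ} (h1 : 0 < y1) (h2 : 0 < y2) (h3 : 0 < y3)
    (hN : 0 ≤ N) (e1 : Φ ≤ N * (y2 * y3)) (e2 : Φ ≤ N * (y1 * y3))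
    (e3 : Φ ≤ N * (y1 * y2)) : Φ ≤ N * PP (2 / 3) y1 y2 y3 := by
  have := rl0 (α := 0) (Φ := Φ) (N := N) (by norm_num) h1 h2 h3 hN (by simpa using e1)
    (by simpa using e2) (by simpa using e3)
  simpa using this

lemma rlρ {α ρ y1 y2 y3 : ℝ} (ha1 : α < 1) (h1 : 0 < y1) (h2 : 0 < y2) (h3 : 0 < y3)
    (hy1 : y1 ≤ ρ) (hy2 : y2 ≤ ρ) (hy3 : y3 ≤ ρ) {p : ℝ} (hp : ρ * p = y1 * y2 * y3) :
    p ≤ ρ ^ (-α) * PP ((2 + α) / 3) y1 y2 y3 := by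
  obtain ⟨q, hq, hq3, hPP, hge, -⟩ := exists_gm h1 h2 h3
  have hρ : 0 < ρ := h1.trans_le hy1
  have e : 3 * ((2 + α) / 3) = 2 + α := by ring
  rw [hPP, e]
  have hqρ : q ≤ ρ := by rcases hge with h | h | h <;> linarith
  have := rl_aux ha1 hq hqρ (hq3.trans hp.symm)
  rw [Real.rpow_neg hρ.le, ← div_eq_inv_mul, le_div_iff₀ (by positivity)]
  linarith

lemma ytest {γ y L A B : ℝ} (hy : 0 < y) (hB : 0 ≤ B) {F : ℝ → ℝ}
    (hF : Tendsto (fun s => F s / s ^ 2) (𝓝[≠] 0) (𝓝 L))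
    (ev : ∀ᶠ s in 𝓝[≠] (0:ℝ), F s ≤ A * ((y + s) ^ γ + (y - s) ^ γ - 2 * y ^ γ)
      + B * ((y + s) ^ (2/3:ℝ) + (y - s) ^ (2/3:ℝ) - 2 * y ^ (2/3:ℝ))) :
    L ≤ A * (γ * (γ - 1) * y ^ (γ - 2)) := by
  have l1 := (rpow_sd γ y hy).const_mul A
  have l2 := (rpow_sd (2/3) y hy).const_mul B
  have h := le_of_tendsto_of_tendsto hF (l1.add l2) (by
    filter_upwards [ev] with s hs
    rw [← mul_div_assoc, ← mul_div_assoc, ← add_div]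
    gcongr)
  have : 0 ≤ B * y ^ ((2/3:ℝ) - 2) := by positivity
  nlinarith

lemma tri_bound {R r y1 y2 y3 : ℝ} {f : V3 → ℝ} (hf : ContDiffOn ℝ 2 f (cube 0 R)) {x : V3}
    (hx : x ∈ cube 0 r) (h1 : 0 ≤ y1) (h2 : 0 ≤ y2) (h3 : 0 ≤ y3) (hr : r + y1 + y2 + y3 ≤ R)
    (a b c : Fin 3) (B : ℝ → ℝ)
    (hB : ∀ y, 0 ≤ y → ∀ v ∈ cube 0 R, ∀ w ∈ cube 0 R, ‖v - w‖ = 2 * y →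
      ∀ i j, |hessM f v i j - hessM f w i j| ≤ B y) :
    |DD (esingle a) y1 (DD (esingle b) y2 (DD (esingle c) y3 f)) x| ≤ 4 * B y1 * (y2 * y3) ∧
    |DD (esingle a) y1 (DD (esingle b) y2 (DD (esingle c) y3 f)) x| ≤ 4 * B y2 * (y1 * y3) ∧
    |DD (esingle a) y1 (DD (esingle b) y2 (DD (esingle c) y3 f)) x| ≤ 4 * B y3 * (y1 * y2) := by
  refine ⟨?_, ?_, ?_⟩
  · have := dd3_bound hf hx h1 h2 h3 hr a b c
      (fun v hv w hw h => hB y1 h1 v hv w hw h _ _)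
    linarith
  · rw [DD_comm (esingle a)]
    have := dd3_bound hf hx h2 h1 h3 (by linarith) b a c
      (fun v hv w hw h => hB y2 h2 v hv w hw h _ _)
    linarith
  · rw [DD_comm (esingle b), DD_comm (esingle a)]
    have := dd3_bound hf hx h3 h1 h2 (by linarith) c a b
      (fun v hv w hw h => hB y3 h3 v hv w hw h _ _)
    linarith

lemma tri_bound0 {R r y1 y2 y3 : ℝ} {g : V3 → ℝ} {x : V3}
    (hx : x ∈ cube 0 r) (h1 : 0 ≤ y1) (h2 : 0 ≤ y2) (h3 : 0 ≤ y3) (hr : r + y1 + y2 + y3 ≤ R)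
    (a b c : Fin 3) (B : ℝ → ℝ)
    (hB : ∀ y, 0 ≤ y → ∀ v ∈ cube 0 R, ∀ w ∈ cube 0 R, ‖v - w‖ = 2 * y → |g v - g w| ≤ B y) :
    |DD (esingle a) y1 (DD (esingle b) y2 (DD (esingle c) y3 g)) x| ≤ 4 * B y1 ∧
    |DD (esingle a) y1 (DD (esingle b) y2 (DD (esingle c) y3 g)) x| ≤ 4 * B y2 ∧
    |DD (esingle a) y1 (DD (esingle b) y2 (DD (esingle c) y3 g)) x| ≤ 4 * B y3 := by
  refine ⟨?_, ?_, ?_⟩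
  · exact d3_bound hx h1 h2 h3 hr a b c (hB y1 h1)
  · rw [DD_comm (esingle a)]
    exact d3_bound hx h2 h1 h3 (by linarith) b a c (hB y2 h2)
  · rw [DD_comm (esingle b), DD_comm (esingle a)]
    exact d3_bound hx h3 h1 h2 (by linarith) c a b (hB y3 h3)

lemma two_mul_rpow_le {α y : ℝ} (ha1 : α < 1) (hy : 0 ≤ y) :
    (2 * y) ^ α ≤ 2 * y ^ α := by
  rw [Real.mul_rpow (by norm_num) hy]
  gcongr
  calc (2:ℝ) ^ α ≤ 2 ^ (1:ℝ) := Real.rpow_le_rpow_of_exponent_le (by norm_num) ha1.le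
    _ = 2 := by simp

/-- diagonal matrix unit -/
def EE (a : Fin 3) : Mat3 := fun i j => if i = a then (if j = a then 1 else 0) else 0

lemma quad_EE (a : Fin 3) (ξ : V3) : quadForm (EE a) ξ = ξ a ^ 2 := by
  fin_cases a <;> simp [quadForm, bilin, EE, Fin.sum_univ_three] <;> ring

lemma dot_EE (a : Fin 3) (G : Mat3) : matDot (EE a) G = G a a := by
  fin_cases a <;> simp [matDot, EE, Fin.sum_univ_three]

lemma tr_EE (a : Fin 3) : ∑ i, EE a i i = 1 := by
  fin_cases a <;> simp [EE]

lemma EE_symm (a i j : Fin 3) : EE a i j = EE a j i := by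
  simp only [EE]; split_ifs <;> rfl

lemma sq_le_norm (ξ : V3) (a : Fin 3) : ξ a ^ 2 ≤ ‖ξ‖ ^ 2 := by
  have := PiLp.norm_apply_le ξ a
  rw [Real.norm_eq_abs] at this
  rw [← sq_abs]
  gcongr

lemma quad_esingle (G : Mat3) (a : Fin 3) : quadForm G (esingle a) = G a a := by
  fin_cases a <;> simp [quadForm, bilin, esingle, Fin.sum_univ_three]

/-- the algebra at an interior maximum -/
lemma ellip {ω Ω κ : ℝ} (hω : 0 < ω) (hκ : 0 ≤ κ) (B G : Mat3) (hs : B.IsSymm)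
    (he : ∀ ξ : V3, ω * ‖ξ‖ ^ 2 ≤ quadForm B ξ ∧ quadForm B ξ ≤ Ω * ‖ξ‖ ^ 2)
    (hG : ∀ ξ : V3, quadForm G ξ ≤ κ * ‖ξ‖ ^ 2) (a b c : Fin 3) :
    matDot B G ≤ 3 * Ω * κ + ω / 3 * (G a a + G b b + G c c) := by
  set A : Mat3 := fun i j => B i j - ω / 3 * (EE a i j + EE b i j + EE c i j) with hA
  have h1 : A.IsSymm := by
    ext i j
    have := hs.apply i j
    change A j i = A i j
    simp only [hA]
    rw [this, EE_symm a j i, EE_symm b j i, EE_symm c j i]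
  have hq : ∀ ξ, quadForm A ξ = quadForm B ξ - ω / 3 * (ξ a ^ 2 + ξ b ^ 2 + ξ c ^ 2) := by
    intro ξ
    rw [← quad_EE a, ← quad_EE b, ← quad_EE c]
    simp only [hA, quadForm, bilin, Fin.sum_univ_three]; ring
  have hd : matDot A G = matDot B G - ω / 3 * (G a a + G b b + G c c) := by
    rw [← dot_EE a G, ← dot_EE b G, ← dot_EE c G]
    simp only [hA, matDot, Fin.sum_univ_three]; ring
  have ht : ∑ i, A i i = ∑ i, B i i - ω := by
    have : ∑ i, A i i = ∑ i, B i i - ω / 3 * (∑ i, EE a i i + ∑ i, EE b i i + ∑ i, EE c i i) := by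
      simp only [hA, Fin.sum_univ_three]; ring
    rw [this, tr_EE, tr_EE, tr_EE]; ring
  have htB : ∑ i, B i i ≤ 3 * Ω := by
    have h := fun i => (he (esingle i)).2
    simp only [quad_esingle, esingle_norm] at h
    rw [Fin.sum_univ_three]
    linarith [h 0, h 1, h 2]
  have hp : ∀ ξ, 0 ≤ quadForm A ξ := by
    intro ξ
    rw [hq]
    have := (he ξ).1
    nlinarith [sq_le_norm ξ a, sq_le_norm ξ b, sq_le_norm ξ c]
  have := matDot_le A G h1 hp κ hG
  rw [hd, ht] at this
  nlinarith

lemma time_test {T t L : ℝ} {f : ℝ → ℝ} (ht : t ∈ Icc 0 T) (ht0 : t ≠ 0)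
    (hd : HasDerivWithinAt f L (Icc 0 T) t) (hm : ∀ s ∈ Icc 0 T, f s ≤ f t) : 0 ≤ L := by
  have h0 : 0 < t := lt_of_le_of_ne ht.1 (Ne.symm ht0)
  have hmem : Icc 0 T ∈ 𝓝[Iio t] t := by
    have : Ioo 0 t ∈ 𝓝[Iio t] t := Ioo_mem_nhdsLT h0
    exact mem_of_superset this (fun s hs => ⟨hs.1.le, hs.2.le.trans ht.2⟩)
  have h1 : HasDerivWithinAt f L (Iio t) t := hd.mono_of_mem_nhdsWithin hmem
  rw [hasDerivWithinAt_iff_tendsto_slope' (by simp)] at h1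
  refine ge_of_tendsto h1 ?_
  filter_upwards [hmem, self_mem_nhdsWithin] with s hs hst
  have hst : s < t := hst
  rw [slope_def_field]
  exact div_nonneg_of_nonpos (by linarith [hm s hs]) (by linarith)

/-- Interior contradiction -/
lemma interior_contra {R T ω Ω α N1 N2 K1 ρ : ℝ} (hα : α ∈ Ioo (0:ℝ) 1) (hρ : 0 < ρ)
    (hω : 0 < ω) (hΩ : 0 ≤ Ω) (hN1 : 0 ≤ N1) (hN2 : 0 ≤ N2) (hK1p : 0 ≤ K1)
    (hK : 8 * N1 + 48 * Ω * N2 * ρ ^ (-α) < ω / 3 * (K1 * ((2 + α) / 3 * (1 - (2 + α) / 3))))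
    (B : Mat3) (hs : B.IsSymm)
    (he : ∀ ξ : V3, ω * ‖ξ‖ ^ 2 ≤ quadForm B ξ ∧ quadForm B ξ ≤ Ω * ‖ξ‖ ^ 2)
    (u : ℝ → V3 → ℝ) (ut : V3 → ℝ) (t : ℝ) (ht : t ∈ Icc 0 T) (ht0 : t ≠ 0)
    (hut : ∀ v ∈ cube 0 R, HasDerivWithinAt (fun s => u s v) (ut v) (Icc 0 T) t)
    (hsp : ContDiffOn ℝ 2 (u t) (cube 0 R))
    (h1 : ∀ v ∈ cube 0 R, ∀ w ∈ cube 0 R,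
      |(ut v - matDot B (hessM (u t) v)) - (ut w - matDot B (hessM (u t) w))| ≤ N1 * ‖v - w‖ ^ α)
    (σ : ℝ) (hσ : |σ| ≤ 1) (a b c : Fin 3) (x0 x : V3) (y1 y2 y3 : ℝ) (r : ℝ)
    (hx : x ∈ cube 0 r) (hr : r + y1 + y2 + y3 ≤ R) (hxx : ‖x - x0‖ < ρ)
    (hy1 : y1 ∈ Ioo 0 ρ) (hy2 : y2 ∈ Ioo 0 ρ) (hy3 : y3 ∈ Ioo 0 ρ)
    (θ : ℝ → V3 → ℝ → ℝ → ℝ → ℝ)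
    (hθ : ∀ t x y1 y2 y3, θ t x y1 y2 y3 =
      σ * DD (esingle a) y1 (DD (esingle b) y2 (DD (esingle c) y3 (u t))) x
        - K1 * PP ((2 + α) / 3) y1 y2 y3 - 8 * N2 / ρ ^ 2 * ‖x - x0‖ ^ 2 * PP (2 / 3) y1 y2 y3)
    (hmax : ∀ t' ∈ Icc 0 T, ∀ x' ∈ Metric.closedBall x0 ρ, ∀ y1' ∈ Icc 0 ρ, ∀ y2' ∈ Icc 0 ρ,
      ∀ y3' ∈ Icc 0 ρ, θ t' x' y1' y2' y3' ≤ θ t x y1 y2 y3) : False := by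
  have hxm : x ∈ Metric.closedBall x0 ρ := by
    rw [Metric.mem_closedBall, dist_eq_norm]; exact hxx.le
  have m1 := Ioo_subset_Icc_self hy1
  have m2 := Ioo_subset_Icc_self hy2
  have m3 := Ioo_subset_Icc_self hy3
  obtain ⟨p1, q1⟩ := hy1
  obtain ⟨p2, q2⟩ := hy2
  obtain ⟨p3, q3⟩ := hy3
  have hP23 : 0 ≤ PP (2/3) y1 y2 y3 := PP_nonneg p1.le p2.le p3.le
  set Dg : (V3 → ℝ) → V3 → ℝ :=
    fun g => DD (esingle a) y1 (DD (esingle b) y2 (DD (esingle c) y3 g)) with hDg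
  set G : Mat3 := fun i j => σ * Dg (fun p => hessM (u t) p i j) x with hG
  have hSD : ∀ ξ, Tendsto (fun s : ℝ => σ * (Dg (u t) (x + s • ξ) + Dg (u t) (x - s • ξ)
      - 2 * Dg (u t) x) / s ^ 2) (𝓝[≠] 0) (𝓝 (quadForm G ξ)) := by
    intro ξ
    have h := (SD3 hsp hx p1.le p2.le p3.le hr a b c ξ).const_mul σ
    have e : quadForm G ξ = σ * Dg (fun p => quadForm (hessM (u t) p) ξ) x := by
      simp only [hDg]
      rw [D3_quad]
      simp only [hG, hDg, quadForm, bilin, Fin.sum_univ_three]; ring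
    rw [e]
    refine h.congr fun s => ?_
    rw [mul_div_assoc]
  -- time derivative
  have htime : 0 ≤ σ * Dg ut x := by
    have hb : ∀ {r R y : ℝ} {p : V3} {c : Fin 3} {w : ℝ → V3 → ℝ} {wt : V3 → ℝ},
        0 ≤ y → r + y ≤ R → p ∈ cube 0 r →
        (∀ v ∈ cube 0 R, HasDerivWithinAt (fun s => w s v) (wt v) (Icc 0 T) t) →
        HasDerivWithinAt (fun s => DD (esingle c) y (w s) p) (DD (esingle c) y wt p) (Icc 0 T) t := by
      intro r R y p c w wt hy hr hp hw
      have hy' := (abs_of_nonneg hy).le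
      exact (hw _ (shift_mem c hp hy' hr)).fun_sub (hw _ (shift_mem' c hp hy' hr))
    have hD : HasDerivWithinAt (fun s => Dg (u s) x) (Dg ut x) (Icc 0 T) t := by
      refine hb (R := r + y1) (w := fun s => DD (esingle b) y2 (DD (esingle c) y3 (u s)))
        p1.le le_rfl hx fun v hv => ?_
      refine hb (R := r + y1 + y2) (w := fun s => DD (esingle c) y3 (u s)) p2.le le_rfl hv
        fun v hv => ?_
      exact hb p3.le hr hv hut
    refine time_test ht ht0 (hD.const_mul σ) fun s hs => ?_
    have := hmax s hs x hxm y1 m1 y2 m2 y3 m3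
    simp only [hθ] at this
    linarith
  -- x directions
  set κ := 16 * N2 / ρ ^ 2 * PP (2 / 3) y1 y2 y3 with hκ
  have hκ0 : 0 ≤ κ := by positivity
  have hGx : ∀ ξ, quadForm G ξ ≤ κ * ‖ξ‖ ^ 2 := by
    intro ξ
    refine le_of_tendsto (hSD ξ) ?_
    have hopen : ∀ᶠ z in 𝓝 x, z ∈ Metric.closedBall x0 ρ := by
      have : Metric.ball x0 ρ ∈ 𝓝 x := Metric.isOpen_ball.mem_nhds (by
        rw [Metric.mem_ball, dist_eq_norm]; exact hxx)
      exact mem_of_superset this Metric.ball_subset_closedBall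
    have t1 : Tendsto (fun s : ℝ => x + s • ξ) (𝓝[≠] 0) (𝓝 x) := by
      have : ContinuousAt (fun s : ℝ => x + s • ξ) 0 := by fun_prop
      have := this.tendsto
      simp only [zero_smul, add_zero] at this
      exact this.mono_left nhdsWithin_le_nhds
    have t2 : Tendsto (fun s : ℝ => x - s • ξ) (𝓝[≠] 0) (𝓝 x) := by
      have : ContinuousAt (fun s : ℝ => x - s • ξ) 0 := by fun_prop
      have := this.tendsto
      simp only [zero_smul, sub_zero] at this
      exact this.mono_left nhdsWithin_le_nhds
    filter_upwards [t1.eventually hopen, t2.eventually hopen, self_mem_nhdsWithin] with s e1 e2 e3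
    have e3 : s ≠ 0 := e3
    have k1 := hmax t ht _ e1 y1 m1 y2 m2 y3 m3
    have k2 := hmax t ht _ e2 y1 m1 y2 m2 y3 m3
    simp only [hθ] at k1 k2
    have hpar := parallelogram_law_with_norm ℝ (x - x0) (s • ξ)
    have v1 : x + s • ξ - x0 = x - x0 + s • ξ := by abel
    have v2 : x - s • ξ - x0 = x - x0 - s • ξ := by abel
    rw [v1] at k1
    rw [v2] at k2
    have hn : ‖s • ξ‖ ^ 2 = s ^ 2 * ‖ξ‖ ^ 2 := by
      rw [norm_smul, mul_pow, Real.norm_eq_abs, sq_abs]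
    rw [hn] at hpar
    rw [div_le_iff₀ (by positivity)]
    have e : κ * ‖ξ‖ ^ 2 * s ^ 2 = 8 * N2 / ρ ^ 2 * PP (2 / 3) y1 y2 y3 *
        (‖x - x0 + s • ξ‖ ^ 2 + ‖x - x0 - s • ξ‖ ^ 2 - 2 * ‖x - x0‖ ^ 2) := by
      rw [hκ]
      have : ‖x - x0 + s • ξ‖ ^ 2 + ‖x - x0 - s • ξ‖ ^ 2 - 2 * ‖x - x0‖ ^ 2
        = 2 * (s ^ 2 * ‖ξ‖ ^ 2) := by linarith
      rw [this]; ring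
    rw [e]
    simp only [hDg]
    linarith
  -- y directions
  have evy : ∀ y : ℝ, 0 < y → y < ρ → ∀ᶠ s in 𝓝[≠] (0:ℝ), y + s ∈ Icc 0 ρ ∧ y - s ∈ Icc 0 ρ := by
    intro y h h'
    have e1 : ∀ᶠ s in 𝓝 (0:ℝ), |s| < min y (ρ - y) := by
      have : ContinuousAt (fun s : ℝ => |s|) 0 := by fun_prop
      exact this.eventually_lt continuousAt_const (by simp; constructor <;> linarith)
    filter_upwards [e1.filter_mono nhdsWithin_le_nhds] with s hs
    have := abs_lt.1 (hs.trans_le (min_le_left _ _))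
    have h2 := abs_lt.1 (hs.trans_le (min_le_right _ _))
    refine ⟨⟨?_, ?_⟩, ⟨?_, ?_⟩⟩ <;> linarith [h2.1, h2.2, this.1, this.2]
  set γ := (2 + α) / 3 with hγ
  have hK2 : 0 ≤ 8 * N2 / ρ ^ 2 * ‖x - x0‖ ^ 2 := by positivity
  have g1 : G a a ≤ K1 * (y2 ^ γ * y3 ^ γ) * (γ * (γ - 1) * y1 ^ (γ - 2)) := by
    rw [← quad_esingle G a]
    refine ytest (B := 8 * N2 / ρ ^ 2 * ‖x - x0‖ ^ 2 * (y2 ^ (2/3:ℝ) * y3 ^ (2/3:ℝ))) p1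
      (by positivity) (hSD (esingle a)) ?_
    filter_upwards [evy y1 p1 q1] with s hs
    have k1 := hmax t ht x hxm _ hs.1 y2 m2 y3 m3
    have k2 := hmax t ht x hxm _ hs.2 y2 m2 y3 m3
    simp only [hθ, PP] at k1 k2
    have k3 := congrArg (σ * ·) (DD_shift (esingle a) y1 s (DD (esingle b) y2 (DD (esingle c) y3 (u t))) x)
    simp only [hDg]
    beta_reduce at k3
    linarith
  have g2 : G b b ≤ K1 * (y1 ^ γ * y3 ^ γ) * (γ * (γ - 1) * y2 ^ (γ - 2)) := by
    rw [← quad_esingle G b]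
    refine ytest (B := 8 * N2 / ρ ^ 2 * ‖x - x0‖ ^ 2 * (y1 ^ (2/3:ℝ) * y3 ^ (2/3:ℝ))) p2
      (by positivity) (hSD (esingle b)) ?_
    filter_upwards [evy y2 p2 q2] with s hs
    have k1 := hmax t ht x hxm y1 m1 _ hs.1 y3 m3
    have k2 := hmax t ht x hxm y1 m1 _ hs.2 y3 m3
    simp only [hθ, PP] at k1 k2
    have k3 := congrArg (σ * ·) (DD_shift2 (esingle b) (esingle a) y2 y1 s (DD (esingle c) y3 (u t)) x)
    simp only [hDg]
    beta_reduce at k3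
    linarith
  have g3 : G c c ≤ K1 * (y1 ^ γ * y2 ^ γ) * (γ * (γ - 1) * y3 ^ (γ - 2)) := by
    rw [← quad_esingle G c]
    refine ytest (B := 8 * N2 / ρ ^ 2 * ‖x - x0‖ ^ 2 * (y1 ^ (2/3:ℝ) * y2 ^ (2/3:ℝ))) p3
      (by positivity) (hSD (esingle c)) ?_
    filter_upwards [evy y3 p3 q3] with s hs
    have k1 := hmax t ht x hxm y1 m1 y2 m2 _ hs.1
    have k2 := hmax t ht x hxm y1 m1 y2 m2 _ hs.2
    simp only [hθ, PP] at k1 k2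
    have k3 := congrArg (σ * ·)
      (DD_shift3 (esingle c) (esingle b) (esingle a) y3 y2 y1 s (u t) x)
    simp only [hDg]
    beta_reduce at k3
    linarith
  -- combine
  have hell := ellip hω hκ0 B G hs he hGx a b c
  have hdot : σ * Dg (fun p => ut p - matDot B (hessM (u t) p)) x = σ * Dg ut x - matDot B G := by
    simp only [hDg]
    rw [D3_dot]
    simp only [hG, hDg, matDot, Fin.sum_univ_three]; ring
  have hFb := tri_bound0 (R := R) (g := fun p => ut p - matDot B (hessM (u t) p)) hx p1.le p2.le
    p3.le hr a b c (fun y => N1 * (2 * y) ^ α) (fun y _ v hv w hw hvw => by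
      have := h1 v hv w hw; rwa [hvw] at this)
  have hFσ : σ * Dg (fun p => ut p - matDot B (hessM (u t) p)) x ≤
      |Dg (fun p => ut p - matDot B (hessM (u t) p)) x| := by
    refine (le_abs_self _).trans ?_
    rw [abs_mul]
    exact mul_le_of_le_one_left (abs_nonneg _) hσ
  obtain ⟨q, hq, hq3, hPP, hge, hle⟩ := exists_gm p1 p2 p3
  have hqρ : q ≤ ρ := by rcases hge with h | h | h <;> linarith
  have hFq : |Dg (fun p => ut p - matDot B (hessM (u t) p)) x| ≤ 8 * N1 * q ^ α := by
    have aux : ∀ y : ℝ, 0 < y → y ≤ q → 4 * (N1 * (2 * y) ^ α) ≤ 8 * N1 * q ^ α := by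
      intro y h h'
      have e1 := two_mul_rpow_le hα.2 h.le
      have e2 : y ^ α ≤ q ^ α := Real.rpow_le_rpow h.le h' hα.1.le
      calc 4 * (N1 * (2 * y) ^ α) ≤ 4 * (N1 * (2 * q ^ α)) := by gcongr; linarith
        _ = _ := by ring
    rcases hle with h | h | h
    · exact hFb.1.trans (aux _ p1 h)
    · exact hFb.2.1.trans (aux _ p2 h)
    · exact hFb.2.2.trans (aux _ p3 h)
  have hγ1 : γ < 1 := by rw [hγ]; linarith [hα.2]
  have hγ0 : 0 < γ := by rw [hγ]; linarith [hα.1]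
  have hgg : 0 ≤ γ * (1 - γ) := mul_nonneg hγ0.le (by linarith)
  -- each term
  have term : ∀ y : ℝ, 0 < y → y ^ (γ - 2) = y ^ γ / y ^ 2 := by
    intro y hy
    rw [Real.rpow_sub hy]; norm_num
  have hPq : PP γ y1 y2 y3 = q ^ (2 + α) := by rw [hPP, hγ]; congr 1; ring
  have hq2 : q ^ (2 + α) = q ^ 2 * q ^ α := by
    rw [Real.rpow_add hq]; norm_num
  have hbig : ∀ y : ℝ, 0 < y → y ≤ q → q ^ α ≤ PP γ y1 y2 y3 / y ^ 2 := by
    intro y hy hyq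
    rw [le_div_iff₀ (by positivity), hPq, hq2, mul_comm]
    gcongr
  have hnn : ∀ y : ℝ, 0 < y → 0 ≤ PP γ y1 y2 y3 / y ^ 2 := by
    intro y hy
    have := PP_nonneg (β := γ) p1.le p2.le p3.le
    positivity
  have hsum : q ^ α ≤ PP γ y1 y2 y3 / y1 ^ 2 + PP γ y1 y2 y3 / y2 ^ 2 + PP γ y1 y2 y3 / y3 ^ 2 := by
    have n1 := hnn y1 p1
    have n2 := hnn y2 p2
    have n3 := hnn y3 p3
    rcases hle with h | h | h
    · linarith [hbig _ p1 h]
    · linarith [hbig _ p2 h]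
    · linarith [hbig _ p3 h]
  have gsum : G a a + G b b + G c c ≤ - (K1 * (γ * (1 - γ)) *
      (PP γ y1 y2 y3 / y1 ^ 2 + PP γ y1 y2 y3 / y2 ^ 2 + PP γ y1 y2 y3 / y3 ^ 2)) := by
    rw [term _ p1] at g1
    rw [term _ p2] at g2
    rw [term _ p3] at g3
    refine (add_le_add (add_le_add g1 g2) g3).trans_eq ?_
    simp only [PP]; ring
  have gsum2 : G a a + G b b + G c c ≤ - (K1 * (γ * (1 - γ)) * q ^ α) := by
    refine gsum.trans ?_
    gcongr
  have hκq : κ ≤ 16 * N2 * (ρ ^ (-α) * q ^ α) := by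
    have e : PP (2/3) y1 y2 y3 = q ^ 2 := by rw [hPP]; norm_num
    rw [hκ, e]
    have h1 : (q / ρ) ^ (2:ℝ) ≤ (q / ρ) ^ α := by
      apply Real.rpow_le_rpow_of_exponent_ge (by positivity) ((div_le_one hρ).2 hqρ)
      linarith [hα.2]
    rw [Real.div_rpow hq.le hρ.le, Real.rpow_two] at h1
    rw [Real.div_rpow hq.le hρ.le, Real.rpow_two] at h1
    rw [Real.rpow_neg hρ.le]
    calc 16 * N2 / ρ ^ 2 * q ^ 2 = 16 * N2 * (q ^ 2 / ρ ^ 2) := by ring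
      _ ≤ 16 * N2 * (q ^ α / ρ ^ α) := by gcongr
      _ = _ := by rw [div_eq_inv_mul]
  have hqa : 0 < q ^ α := by positivity
  have f1 : 3 * Ω * κ ≤ 3 * Ω * (16 * N2 * (ρ ^ (-α) * q ^ α)) := by gcongr
  have f2 := mul_le_mul_of_nonneg_left gsum2 (by positivity : 0 ≤ ω / 3)
  have f3 := mul_lt_mul_of_pos_right hK hqa
  linarith

/-- substitution continuity -/
def GoodCont {X : Type*} [TopologicalSpace X] (F : X → V3 → ℝ) (S : Set X) (r : ℝ) : Prop :=
  ∀ z : X → V3, ContinuousOn z S → (∀ p ∈ S, z p ∈ cube 0 r) → ContinuousOn (fun p => F p (z p)) S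

lemma GoodCont_DD {X : Type*} [TopologicalSpace X] {F : X → V3 → ℝ} {S : Set X} {r ρ R : ℝ}
    (hF : GoodCont F S R) (y : X → ℝ) (hy : ContinuousOn y S) (hyρ : ∀ p ∈ S, y p ∈ Icc 0 ρ)
    (hr : r + ρ ≤ R) (a : Fin 3) : GoodCont (fun p => DD (esingle a) (y p) (F p)) S r := by
  intro z hz hzr
  simp only [DD]
  have hab : ∀ p ∈ S, |y p| ≤ ρ := fun p hp => by
    rw [abs_of_nonneg (hyρ p hp).1]; exact (hyρ p hp).2
  refine ContinuousOn.sub (hF _ (hz.add (hy.smul continuousOn_const)) fun p hp => ?_)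
    (hF _ (hz.sub (hy.smul continuousOn_const)) fun p hp => ?_)
  · exact shift_mem a (hzr p hp) (hab p hp) hr
  · exact shift_mem' a (hzr p hp) (hab p hp) hr

lemma ball_cube {x0 x : V3} {r ρ : ℝ} (hx0 : x0 ∈ cube 0 r) (hx : ‖x - x0‖ ≤ ρ) :
    x ∈ cube 0 (r + ρ) := by
  rw [mem_cube0] at *
  intro i
  have h1 := PiLp.norm_apply_le (x - x0) i
  simp only [PiLp.sub_apply, Real.norm_eq_abs] at h1
  have h2 := abs_add_le (x0 i) (x i - x0 i)
  rw [add_sub_cancel] at h2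
  linarith [hx0 i]

lemma third_le {R T ω Ω α N0 N1 N2 K1 ρ : ℝ} (hα : α ∈ Ioo (0:ℝ) 1) (hρ : 0 < ρ)
    (hρR : 8 * ρ = R)
    (hω : 0 < ω) (hΩ : 0 ≤ Ω) (hN0 : 0 ≤ N0) (hN1 : 0 ≤ N1) (hN2 : 0 ≤ N2)
    (hK10 : 8 * N0 ≤ K1) (hK12 : 8 * N2 * ρ ^ (-α) ≤ K1)
    (hK : 8 * N1 + 48 * Ω * N2 * ρ ^ (-α) < ω / 3 * (K1 * ((2 + α) / 3 * (1 - (2 + α) / 3))))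
    (B : ℝ → Mat3) (hs : ∀ t ∈ Icc 0 T, (B t).IsSymm)
    (he : ∀ t ∈ Icc 0 T, ∀ ξ : V3, ω * ‖ξ‖ ^ 2 ≤ quadForm (B t) ξ ∧ quadForm (B t) ξ ≤ Ω * ‖ξ‖ ^ 2)
    (u : ℝ → V3 → ℝ) (ut : ℝ → V3 → ℝ)
    (hcont : ContinuousOn (fun p : ℝ × V3 => u p.1 p.2) (Icc 0 T ×ˢ cube 0 R))
    (hut : ∀ t ∈ Icc 0 T, ∀ v ∈ cube 0 R,
      HasDerivWithinAt (fun s => u s v) (ut t v) (Icc 0 T) t)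
    (hsp : ∀ t ∈ Icc 0 T, ContDiffOn ℝ 2 (u t) (cube 0 R))
    (h0 : ∀ v ∈ cube 0 R, ∀ w ∈ cube 0 R, ∀ i j,
      |hessM (u 0) v i j - hessM (u 0) w i j| ≤ N0 * ‖v - w‖ ^ α)
    (h1 : ∀ t ∈ Icc 0 T, ∀ v ∈ cube 0 R, ∀ w ∈ cube 0 R,
      |(ut t v - matDot (B t) (hessM (u t) v)) - (ut t w - matDot (B t) (hessM (u t) w))|
        ≤ N1 * ‖v - w‖ ^ α)
    (h2 : ∀ t ∈ Icc 0 T, ∀ v ∈ cube 0 R, ∀ i j, |hessM (u t) v i j| ≤ N2)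
    (σ : ℝ) (hσ : |σ| ≤ 1) (a b c : Fin 3) (x0 : V3) (hx0 : x0 ∈ cube 0 (4 * ρ)) 
    (t : ℝ) (ht : t ∈ Icc 0 T) (y1 y2 y3 : ℝ)
    (hy1 : y1 ∈ Icc 0 ρ) (hy2 : y2 ∈ Icc 0 ρ) (hy3 : y3 ∈ Icc 0 ρ) :
    σ * DD (esingle a) y1 (DD (esingle b) y2 (DD (esingle c) y3 (u t))) x0
      ≤ K1 * PP ((2 + α) / 3) y1 y2 y3 := by
  have hK1p : 0 ≤ K1 := by linarith
  set θ : ℝ → V3 → ℝ → ℝ → ℝ → ℝ := fun t x y1 y2 y3 =>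
    σ * DD (esingle a) y1 (DD (esingle b) y2 (DD (esingle c) y3 (u t))) x
        - K1 * PP ((2 + α) / 3) y1 y2 y3 - 8 * N2 / ρ ^ 2 * ‖x - x0‖ ^ 2 * PP (2 / 3) y1 y2 y3
    with hθ
  set S : Set (ℝ × V3 × ℝ × ℝ × ℝ) :=
    Icc 0 T ×ˢ Metric.closedBall x0 ρ ×ˢ Icc 0 ρ ×ˢ Icc 0 ρ ×ˢ Icc 0 ρ with hS
  have hSc : IsCompact S :=
    isCompact_Icc.prod ((isCompact_closedBall x0 ρ).prod (isCompact_Icc.prod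
      (isCompact_Icc.prod isCompact_Icc)))
  have hcb : ∀ x ∈ Metric.closedBall x0 ρ, x ∈ cube 0 (5 * ρ) := by
    intro x hx
    rw [Metric.mem_closedBall, dist_eq_norm] at hx
    have := ball_cube hx0 hx
    rwa [show 4 * ρ + ρ = 5 * ρ by ring] at this
  have hSne : S.Nonempty := ⟨(t, x0, y1, y2, y3), ht, Metric.mem_closedBall_self hρ.le, hy1, hy2, hy3⟩
  have hθc : ContinuousOn (fun p : ℝ × V3 × ℝ × ℝ × ℝ => θ p.1 p.2.1 p.2.2.1 p.2.2.2.1 p.2.2.2.2) S := by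
    have b0 : GoodCont (fun p : ℝ × V3 × ℝ × ℝ × ℝ => u p.1) S R := by
      intro z hz hzR
      exact hcont.comp (continuous_fst.continuousOn.prodMk hz)
        (fun p hp => ⟨hp.1, hzR p hp⟩)
    have b1 := GoodCont_DD (r := 7 * ρ) (ρ := ρ) b0 (fun p => p.2.2.2.2) (by fun_prop)
      (fun p hp => hp.2.2.2.2) (by linarith) c
    have b2 := GoodCont_DD (r := 6 * ρ) (ρ := ρ) b1 (fun p => p.2.2.2.1) (by fun_prop)
      (fun p hp => hp.2.2.2.1) (by linarith) b
    have b3 := GoodCont_DD (r := 5 * ρ) (ρ := ρ) b2 (fun p => p.2.2.1) (by fun_prop)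
      (fun p hp => hp.2.2.1) (by linarith) a
    have b4 := b3 (fun p => p.2.1) (by fun_prop) (fun p hp => hcb _ hp.2.1)
    have hPPc : ∀ β : ℝ, 0 ≤ β →
        Continuous (fun p : ℝ × V3 × ℝ × ℝ × ℝ => PP β p.2.2.1 p.2.2.2.1 p.2.2.2.2) := by
      intro β hβ
      unfold PP
      exact (((continuous_fst.comp (continuous_snd.comp continuous_snd)).rpow_const
        (fun _ => Or.inr hβ)).mul ((continuous_fst.comp (continuous_snd.comp
          (continuous_snd.comp continuous_snd))).rpow_const (fun _ => Or.inr hβ))).mul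
        ((continuous_snd.comp (continuous_snd.comp
          (continuous_snd.comp continuous_snd))).rpow_const (fun _ => Or.inr hβ))
    have c1 := hPPc ((2 + α) / 3) (by linarith [hα.1])
    have c2 := hPPc (2 / 3) (by norm_num)
    simp only [hθ]
    refine ((continuousOn_const.mul b4).sub (continuousOn_const.mul c1.continuousOn)).sub
      (ContinuousOn.mul (Continuous.continuousOn ?_) c2.continuousOn)
    fun_prop
  obtain ⟨⟨t', x', z1, z2, z3⟩, hmem, hmx⟩ := hSc.exists_isMaxOn hSne hθc
  obtain ⟨ht', hx', hz1, hz2, hz3⟩ := hmem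
  simp only at ht' hx' hz1 hz2 hz3
  have hmax : ∀ s ∈ Icc 0 T, ∀ x ∈ Metric.closedBall x0 ρ, ∀ w1 ∈ Icc 0 ρ, ∀ w2 ∈ Icc 0 ρ,
      ∀ w3 ∈ Icc 0 ρ, θ s x w1 w2 w3 ≤ θ t' x' z1 z2 z3 := fun s hs x hx w1 hw1 w2 hw2 w3 hw3 =>
    hmx (show (s, x, w1, w2, w3) ∈ S from ⟨hs, hx, hw1, hw2, hw3⟩)
  have hx5 := hcb x' hx'
  have hr5 : 5 * ρ + z1 + z2 + z3 ≤ R := by linarith [hz1.2, hz2.2, hz3.2]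
  suffices hle : θ t' x' z1 z2 z3 ≤ 0 by
    have := (hmax t ht x0 (Metric.mem_closedBall_self hρ.le) y1 hy1 y2 hy2 y3 hy3).trans hle
    simp only [hθ, sub_self, norm_zero] at this
    linarith
  have hθle : ∀ X : ℝ, |DD (esingle a) z1 (DD (esingle b) z2 (DD (esingle c) z3 (u t'))) x'| ≤ X →
      θ t' x' z1 z2 z3 ≤ X - K1 * PP ((2 + α) / 3) z1 z2 z3
        - 8 * N2 / ρ ^ 2 * ‖x' - x0‖ ^ 2 * PP (2 / 3) z1 z2 z3 := by
    intro X hX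
    simp only [hθ]
    have : σ * DD (esingle a) z1 (DD (esingle b) z2 (DD (esingle c) z3 (u t'))) x' ≤ X := by
      refine (le_abs_self _).trans (le_trans ?_ hX)
      rw [abs_mul]
      exact mul_le_of_le_one_left (abs_nonneg _) hσ
    linarith
  have nn1 : 0 ≤ PP ((2 + α) / 3) z1 z2 z3 := PP_nonneg hz1.1 hz2.1 hz3.1
  have nn2 : 0 ≤ 8 * N2 / ρ ^ 2 * ‖x' - x0‖ ^ 2 * PP (2 / 3) z1 z2 z3 := by
    have : 0 ≤ PP (2 / 3) z1 z2 z3 := PP_nonneg hz1.1 hz2.1 hz3.1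
    positivity
  have nn1' := mul_nonneg hK1p nn1
  have T2 := tri_bound (hsp t' ht') hx5 hz1.1 hz2.1 hz3.1 hr5 a b c (fun _ => 2 * N2)
    (fun y _ v hv w hw _ i j => by
      have e1 := h2 t' ht' v hv i j
      have e2 := h2 t' ht' w hw i j
      rw [abs_le] at *
      constructor <;> linarith)
  rcases eq_or_lt_of_le hz1.1 with e | p1
  · have := hθle 0 (T2.2.1.trans_eq (by rw [← e]; ring))
    linarith
  rcases eq_or_lt_of_le hz2.1 with e | p2
  · have := hθle 0 (T2.1.trans_eq (by rw [← e]; ring))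
    linarith
  rcases eq_or_lt_of_le hz3.1 with e | p3
  · have := hθle 0 (T2.1.trans_eq (by rw [← e]; ring))
    linarith
  have fin1 : |DD (esingle a) z1 (DD (esingle b) z2 (DD (esingle c) z3 (u t'))) x'|
      ≤ K1 * PP ((2 + α) / 3) z1 z2 z3 → θ t' x' z1 z2 z3 ≤ 0 := fun h => by
    have := hθle _ h
    linarith
  have hK2' : 8 * N2 * (ρ ^ (-α) * PP ((2 + α) / 3) z1 z2 z3) ≤ K1 * PP ((2 + α) / 3) z1 z2 z3 := by
    rw [← mul_assoc]; gcongr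
  by_cases ht0 : t' = 0
  · apply fin1
    subst ht0
    have T0 := tri_bound (hsp 0 ht') hx5 hz1.1 hz2.1 hz3.1 hr5 a b c (fun y => N0 * (2 * y) ^ α)
      (fun y _ v hv w hw hvw i j => by
        have := h0 v hv w hw i j; rwa [hvw] at this)
    have k : ∀ y p : ℝ, 0 < y → 0 ≤ p → 4 * (N0 * (2 * y) ^ α) * p ≤ 8 * N0 * (y ^ α * p) := by
      intro y p hy hp
      have := two_mul_rpow_le hα.2 hy.le
      calc 4 * (N0 * (2 * y) ^ α) * p ≤ 4 * (N0 * (2 * y ^ α)) * p := by gcongr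
        _ = _ := by ring
    refine (rl0 hα.2 p1 p2 p3 (by positivity : 0 ≤ 8 * N0) (T0.1.trans (k _ _ p1 (by positivity)))
      (T0.2.1.trans (k _ _ p2 (by positivity))) (T0.2.2.trans (k _ _ p3 (by positivity)))).trans ?_
    gcongr
  rcases eq_or_lt_of_le hz1.2 with e | q1
  · apply fin1
    have := rlρ hα.2 p1 p2 p3 hz1.2 hz2.2 hz3.2 (p := z2 * z3) (by rw [← e]; ring)
    calc _ ≤ 8 * N2 * (z2 * z3) := T2.1.trans_eq (by ring)
      _ ≤ _ := (by gcongr : _ ≤ 8 * N2 * (ρ ^ (-α) * PP ((2 + α) / 3) z1 z2 z3)).trans hK2'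
  rcases eq_or_lt_of_le hz2.2 with e | q2
  · apply fin1
    have := rlρ hα.2 p1 p2 p3 hz1.2 hz2.2 hz3.2 (p := z1 * z3) (by rw [← e]; ring)
    calc _ ≤ 8 * N2 * (z1 * z3) := T2.2.1.trans_eq (by ring)
      _ ≤ _ := (by gcongr : _ ≤ 8 * N2 * (ρ ^ (-α) * PP ((2 + α) / 3) z1 z2 z3)).trans hK2'
  rcases eq_or_lt_of_le hz3.2 with e | q3
  · apply fin1
    have := rlρ hα.2 p1 p2 p3 hz1.2 hz2.2 hz3.2 (p := z1 * z2) (by rw [← e]; ring)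
    calc _ ≤ 8 * N2 * (z1 * z2) := T2.2.2.trans_eq (by ring)
      _ ≤ _ := (by gcongr : _ ≤ 8 * N2 * (ρ ^ (-α) * PP ((2 + α) / 3) z1 z2 z3)).trans hK2'
  have hx'' := hx'
  rw [Metric.mem_closedBall, dist_eq_norm] at hx''
  rcases eq_or_lt_of_le hx'' with e | qx
  · have := rl2 (N := 8 * N2) p1 p2 p3 (by positivity) (T2.1.trans_eq (by ring))
      (T2.2.1.trans_eq (by ring)) (T2.2.2.trans_eq (by ring))
    have := hθle _ this
    rw [e, div_mul_cancel₀ _ (by positivity)] at this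
    linarith
  exact (interior_contra hα hρ hω hΩ hN1 hN2 hK1p hK (B t') (hs t' ht') (he t' ht') u (ut t') t' ht'
    ht0 (hut t' ht') (hsp t' ht') (h1 t' ht') σ hσ a b c x0 x' z1 z2 z3 (5 * ρ) hx5 hr5 qx
    ⟨p1, q1⟩ ⟨p2, q2⟩ ⟨p3, q3⟩ θ (fun _ _ _ _ _ => rfl) hmax).elim

/-- Bound on third differences. -/
lemma third_abs {R T ω Ω α N0 N1 N2 ρ : ℝ} (hα : α ∈ Ioo (0:ℝ) 1) (hρ : 0 < ρ)
    (hρR : 8 * ρ = R)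
    (hω : 0 < ω) (hΩ : 0 ≤ Ω) (hN0 : 0 ≤ N0) (hN1 : 0 ≤ N1) (hN2 : 0 ≤ N2)
    (B : ℝ → Mat3) (hs : ∀ t ∈ Icc 0 T, (B t).IsSymm)
    (he : ∀ t ∈ Icc 0 T, ∀ ξ : V3, ω * ‖ξ‖ ^ 2 ≤ quadForm (B t) ξ ∧ quadForm (B t) ξ ≤ Ω * ‖ξ‖ ^ 2)
    (u : ℝ → V3 → ℝ) (ut : ℝ → V3 → ℝ)
    (hcont : ContinuousOn (fun p : ℝ × V3 => u p.1 p.2) (Icc 0 T ×ˢ cube 0 R))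
    (hut : ∀ t ∈ Icc 0 T, ∀ v ∈ cube 0 R,
      HasDerivWithinAt (fun s => u s v) (ut t v) (Icc 0 T) t)
    (hsp : ∀ t ∈ Icc 0 T, ContDiffOn ℝ 2 (u t) (cube 0 R))
    (h0 : ∀ v ∈ cube 0 R, ∀ w ∈ cube 0 R, ∀ i j,
      |hessM (u 0) v i j - hessM (u 0) w i j| ≤ N0 * ‖v - w‖ ^ α)
    (h1 : ∀ t ∈ Icc 0 T, ∀ v ∈ cube 0 R, ∀ w ∈ cube 0 R,
      |(ut t v - matDot (B t) (hessM (u t) v)) - (ut t w - matDot (B t) (hessM (u t) w))|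
        ≤ N1 * ‖v - w‖ ^ α)
    (h2 : ∀ t ∈ Icc 0 T, ∀ v ∈ cube 0 R, ∀ i j, |hessM (u t) v i j| ≤ N2)
    (a b c : Fin 3) (x0 : V3) (hx0 : x0 ∈ cube 0 (4 * ρ)) 
    (t : ℝ) (ht : t ∈ Icc 0 T) (y1 y2 y3 : ℝ)
    (hy1 : y1 ∈ Icc 0 ρ) (hy2 : y2 ∈ Icc 0 ρ) (hy3 : y3 ∈ Icc 0 ρ) :
    |DD (esingle a) y1 (DD (esingle b) y2 (DD (esingle c) y3 (u t))) x0|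
      ≤ (8 + 144 / ((2 + α) / 3 * (1 - (2 + α) / 3))) *
        (N0 + ω⁻¹ * N1 + ρ ^ (-α) * (1 + ω⁻¹ * Ω) * N2) * PP ((2 + α) / 3) y1 y2 y3 := by
  set g := (2 + α) / 3 * (1 - (2 + α) / 3) with hg
  have hg0 : 0 < g := mul_pos (by linarith [hα.1]) (by linarith [hα.2])
  set M := N0 + ω⁻¹ * N1 + ρ ^ (-α) * (1 + ω⁻¹ * Ω) * N2 with hM
  have hr0 : 0 < ρ ^ (-α) := by positivity
  have hω' : 0 < ω⁻¹ := by positivity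
  have n1 : 0 ≤ ω⁻¹ * N1 := by positivity
  have n2 : 0 ≤ ρ ^ (-α) * N2 := by positivity
  have n3 : 0 ≤ ρ ^ (-α) * (ω⁻¹ * Ω) * N2 := by positivity
  have hMs : M = N0 + ω⁻¹ * N1 + ρ ^ (-α) * N2 + ρ ^ (-α) * (ω⁻¹ * Ω) * N2 := by rw [hM]; ring
  have hM0 : 0 ≤ M := by rw [hMs]; linarith
  have hq : 0 ≤ 144 / g * M := by positivity
  have main : ∀ ε : ℝ, 0 < ε → ∀ σ : ℝ, |σ| ≤ 1 →
      σ * DD (esingle a) y1 (DD (esingle b) y2 (DD (esingle c) y3 (u t))) x0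
      ≤ ((8 + 144 / g) * M + ε) * PP ((2 + α) / 3) y1 y2 y3 := by
    intro ε hε σ hσ
    refine third_le hα hρ hρR hω hΩ hN0 hN1 hN2 ?_ ?_ ?_ B hs he u ut hcont hut hsp h0 h1 h2 σ hσ
      a b c x0 hx0 t ht y1 y2 y3 hy1 hy2 hy3
    · linarith
    · linarith
    · rw [← hg]
      have e : ω / 3 * (((8 + 144 / g) * M + ε) * g) = ω / 3 * (8 * M * g) + 48 * (ω * M)
          + ω / 3 * (ε * g) := by field_simp; ring
      have e2 : ω * M = ω * N0 + N1 + ω * (ρ ^ (-α) * N2) + ρ ^ (-α) * Ω * N2 := by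
        rw [hMs]; field_simp
      rw [e, e2]
      have i1 : 0 < ω / 3 * (ε * g) := by positivity
      have i2 : 0 ≤ ω / 3 * (8 * M * g) := by positivity
      have i3 : 0 ≤ ω * N0 := by positivity
      have i4 : 0 ≤ ω * (ρ ^ (-α) * N2) := by positivity
      linarith
  have hP : 0 ≤ PP ((2 + α) / 3) y1 y2 y3 := PP_nonneg hy1.1 hy2.1 hy3.1
  have main2 : ∀ σ : ℝ, |σ| ≤ 1 →
      σ * DD (esingle a) y1 (DD (esingle b) y2 (DD (esingle c) y3 (u t))) x0
      ≤ (8 + 144 / g) * M * PP ((2 + α) / 3) y1 y2 y3 := by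
    intro σ hσ
    refine ge_of_tendsto (f := fun ε : ℝ => ((8 + 144 / g) * M + ε) * PP ((2 + α) / 3) y1 y2 y3)
      (x := 𝓝[>] (0:ℝ)) ?_ ?_
    · have : ContinuousAt (fun ε : ℝ => ((8 + 144 / g) * M + ε) * PP ((2 + α) / 3) y1 y2 y3) 0 := by
        fun_prop
      have := this.tendsto
      rw [add_zero] at this
      exact this.mono_left nhdsWithin_le_nhds
    · filter_upwards [self_mem_nhdsWithin] with ε hε
      exact main ε hε σ hσ
  rw [abs_le]
  have m1 := main2 1 (by simp)
  have m2 := main2 (-1) (by simp)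
  constructor <;> linarith

lemma norm_le_three {F : Type*} [NormedAddCommGroup F] [NormedSpace ℝ F] (L : V3 →L[ℝ] F) {M : ℝ}
    (hM : 0 ≤ M) (h : ∀ i, ‖L (esingle i)‖ ≤ M) : ‖L‖ ≤ 3 * M := by
  refine L.opNorm_le_bound (by positivity) fun v => ?_
  have e : L v = ∑ i, v i • L (esingle i) := by
    conv_lhs => rw [vec_expand v]
    simp
  rw [e]
  refine (norm_sum_le _ _).trans ?_
  have : ∀ i, ‖v i • L (esingle i)‖ ≤ M * ‖v‖ := by
    intro i
    rw [norm_smul, mul_comm]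
    exact mul_le_mul (h i) (PiLp.norm_apply_le v i) (norm_nonneg _) hM
  refine (Finset.sum_le_sum fun i _ => this i).trans ?_
  simp; linarith

lemma norm_le_cube {v : V3} {R : ℝ} (hv : v ∈ cube 0 R) : ‖v‖ ≤ 3 * R := by
  rw [mem_cube0] at hv
  rw [vec_expand v]
  refine (norm_sum_le _ _).trans ?_
  have : ∀ i, ‖v i • esingle i‖ ≤ R := by
    intro i
    rw [norm_smul, esingle_norm, mul_one, Real.norm_eq_abs]; exact (hv i).le
  refine (Finset.sum_le_sum fun i _ => this i).trans ?_
  simp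

lemma joint_cont {R T N2 : ℝ} (hR : 0 < R) (hN2 : 0 ≤ N2) (u : ℝ → V3 → ℝ)
    (htime : ∀ v ∈ cube 0 R, ContinuousOn (fun t => u t v) (Icc 0 T))
    (hsp : ∀ t ∈ Icc 0 T, ContDiffOn ℝ 2 (u t) (cube 0 R))
    (h2 : ∀ t ∈ Icc 0 T, ∀ v ∈ cube 0 R, ∀ i j, |hessM (u t) v i j| ≤ N2) :
    ContinuousOn (fun p : ℝ × V3 => u p.1 p.2) (Icc 0 T ×ˢ cube 0 R) := by
  have z0 : (0 : V3) ∈ cube 0 R := by rw [mem_cube0]; intro i; simpa using hR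
  have hr : ∀ i, (R / 2) • esingle i ∈ cube 0 R := by
    intro i
    have z1 : (0 : V3) ∈ cube 0 (R / 2) := by rw [mem_cube0]; intro i; simpa using hR
    have := shift_mem (R := R) (y := R / 2) (s := R / 2) i z1 (abs_of_pos (by positivity)).le (by linarith)
    simpa using this
  have hcd : ∀ t ∈ Icc 0 T, ∀ v ∈ cube 0 R, ContDiffAt ℝ 2 (u t) v := fun t ht v hv =>
    (hsp t ht).contDiffAt ((cube_open R).mem_nhds hv)
  have hd1 : ∀ t ∈ Icc 0 T, ∀ v ∈ cube 0 R, DifferentiableAt ℝ (u t) v := fun t ht v hv =>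
    (hcd t ht v hv).differentiableAt (by norm_num)
  have hd2 : ∀ t ∈ Icc 0 T, ∀ v ∈ cube 0 R, DifferentiableAt ℝ (fderiv ℝ (u t)) v :=
    fun t ht v hv => ((hcd t ht v hv).fderiv_right (m := 1) (by norm_num)).differentiableAt
      (by norm_num)
  have hH : ∀ t ∈ Icc 0 T, ∀ v ∈ cube 0 R, ‖fderiv ℝ (fderiv ℝ (u t)) v‖ ≤ 3 * (3 * N2) := by
    intro t ht v hv
    refine norm_le_three _ (by positivity) fun i => norm_le_three _ hN2 fun j => ?_
    exact h2 t ht v hv i j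
  have hL : ∀ t ∈ Icc 0 T, ∀ v ∈ cube 0 R,
      ‖fderiv ℝ (u t) v - fderiv ℝ (u t) 0‖ ≤ 3 * (3 * N2) * (3 * R) := by
    intro t ht v hv
    have := (cube_convex R).norm_image_sub_le_of_norm_fderiv_le (hd2 t ht) (hH t ht) z0 hv
    refine this.trans ?_
    rw [sub_zero]
    gcongr
    exact norm_le_cube hv
  have hbd : ∀ v ∈ cube 0 R, ∃ C, ∀ t ∈ Icc 0 T, ‖u t v‖ ≤ C := fun v hv =>
    isCompact_Icc.exists_bound_of_continuousOn (htime v hv)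
  obtain ⟨C0, hC0⟩ := hbd 0 z0
  choose C1 hC1 using fun i => hbd _ (hr i)
  set C := 3 * (3 * N2) * (3 * R) with hC
  set M := |C0| + ∑ i, |C1 i| + C * (R / 2) with hM
  have hMi : ∀ i, C0 + C1 i + C * (R / 2) ≤ M := by
    intro i
    have := Finset.single_le_sum (f := fun i => |C1 i|) (fun i _ => abs_nonneg _) (Finset.mem_univ i)
    have k1 := le_abs_self (C1 i)
    have k2 := le_abs_self C0
    linarith
  have hM0 : 0 ≤ M := by
    have : 0 ≤ ∑ i, |C1 i| := Finset.sum_nonneg fun i _ => abs_nonneg _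
    have := abs_nonneg C0
    positivity
  have hg0 : ∀ t ∈ Icc 0 T, ‖fderiv ℝ (u t) 0‖ ≤ 3 * (M / (R / 2)) := by
    intro t ht
    refine norm_le_three _ (by positivity) fun i => ?_
    have k := (cube_convex R).norm_image_sub_le_of_norm_fderiv_le' (hd1 t ht) (hL t ht) z0 (hr i)
    rw [sub_zero, norm_smul, esingle_norm, mul_one, map_smul, Real.norm_eq_abs (R / 2),
      abs_of_pos (by positivity)] at k
    have k0 := hC0 t ht
    have k1 := hC1 i t ht
    rw [le_div_iff₀ (by positivity)]
    have e : ‖fderiv ℝ (u t) 0 (esingle i)‖ * (R / 2) = ‖(R / 2) • fderiv ℝ (u t) 0 (esingle i)‖ := by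
      rw [norm_smul, Real.norm_eq_abs (R / 2), abs_of_pos (by positivity), mul_comm]
    rw [e]
    refine le_trans ?_ (hMi i)
    rw [Real.norm_eq_abs, abs_le] at *
    constructor <;> linarith [k.1, k.2, k0.1, k0.2, k1.1, k1.2]
  have hLip : ∀ t ∈ Icc 0 T, LipschitzOnWith (C + 3 * (M / (R / 2))).toNNReal (u t) (cube 0 R) := by
    intro t ht
    refine (cube_convex R).lipschitzOnWith_of_nnnorm_fderiv_le (hd1 t ht) fun v hv => ?_
    rw [← NNReal.coe_le_coe, coe_nnnorm]
    refine le_trans ?_ (Real.le_coe_toNNReal _)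
    have := norm_add_le (fderiv ℝ (u t) v - fderiv ℝ (u t) 0) (fderiv ℝ (u t) 0)
    rw [sub_add_cancel] at this
    linarith [hL t ht v hv, hg0 t ht]
  exact continuousOn_prod_of_continuousOn_lipschitzOnWith' (fun p : ℝ × V3 => u p.1 p.2) _
    hLip htime

lemma DD_two (d : V3) (s : ℝ) (g : V3 → ℝ) (x : V3) :
    DD d (2 * s) g x = DD d s g (x + s • d) + DD d s g (x - s • d) := by
  simp only [DD]
  have e1 : x + (2 * s) • d = x + s • d + s • d := by module
  have e2 : x - (2 * s) • d = x - s • d - s • d := by module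
  rw [e1, e2, add_sub_cancel_right, sub_add_cancel]; ring

lemma DD_four (d d' : V3) (s : ℝ) (f : V3 → ℝ) (x : V3) :
    DD d (2 * s) (DD d' (2 * s) f) x =
      DD d s (DD d' s f) (x + s • d + s • d') + DD d s (DD d' s f) (x + s • d - s • d')
      + (DD d s (DD d' s f) (x - s • d + s • d') + DD d s (DD d' s f) (x - s • d - s • d')) := by
  rw [DD_two, DD_comm d d' s (2 * s), DD_two, DD_two, DD_comm d' d]

lemma PP_diag {α s : ℝ} (hs : 0 < s) : PP ((2 + α) / 3) s s s = s ^ 2 * s ^ α := by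
  have : PP ((2 + α) / 3) s s s = s ^ (2 + α) := by
    simp only [PP]
    rw [← Real.rpow_add hs, ← Real.rpow_add hs]; congr 1; ring
  rw [this, Real.rpow_add hs]; norm_num

lemma hess_lim {R r : ℝ} {f : V3 → ℝ} (hf : ContDiffOn ℝ 2 f (cube 0 R)) (hr : r < R) {x : V3}
    (hx : x ∈ cube 0 r) (i j : Fin 3) :
    Tendsto (fun s : ℝ => DD (esingle j) s (DD (esingle i) s f) x / (4 * s ^ 2)) (𝓝[>] 0)
      (𝓝 (hessM f x i j)) := by
  have hxR : x ∈ cube 0 R := by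
    rw [mem_cube0] at *; intro k; linarith [hx k]
  have hc : ContDiffAt ℝ 2 f x := hf.contDiffAt ((cube_open R).mem_nhds hxR)
  have hcont : ContinuousAt (fun v => hessM f v i j) x := by
    have h1 : ContDiffAt ℝ 0 (fderiv ℝ (fderiv ℝ f)) x :=
      (hc.fderiv_right (m := 1) (by norm_num)).fderiv_right (m := 0) (by norm_num)
    have h2 := h1.continuousAt
    unfold hessM
    exact (h2.clm_apply continuousAt_const).clm_apply continuousAt_const
  rw [Metric.tendsto_nhdsWithin_nhds]
  intro ε hε
  obtain ⟨δ, hδ, hd⟩ := Metric.continuousAt_iff.1 hcont (ε / 2) (by positivity)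
  refine ⟨min (δ / 2) ((R - r) / 2), lt_min (by positivity) (by linarith), fun s hs hsd => ?_⟩
  have hs : 0 < s := hs
  rw [Real.dist_eq, sub_zero, abs_of_pos hs] at hsd
  have b1 := hsd.trans_le (min_le_left _ _)
  have b2 := hsd.trans_le (min_le_right _ _)
  have k := dd2_bound (c := hessM f x i j) (B := ε / 2) hf hx hs.le hs.le (by linarith) j i
    (fun p hp q hq => by
      have hp' := abs_le.2 hp
      have hq' := abs_le.2 hq
      have : dist (x + p • esingle j + q • esingle i) x < δ := by
        rw [dist_eq_norm, show x + p • esingle j + q • esingle i - x = p • esingle j + q • esingle i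
          by abel]
        refine (norm_add_le _ _).trans_lt ?_
        rw [norm_smul, norm_smul, esingle_norm, esingle_norm, Real.norm_eq_abs, Real.norm_eq_abs]
        linarith
      have := hd this
      rw [Real.dist_eq] at this
      exact this.le)
  rw [Real.dist_eq]
  have hs2 : 0 < 4 * s ^ 2 := by positivity
  have e : DD (esingle j) s (DD (esingle i) s f) x / (4 * s ^ 2) - hessM f x i j =
      (DD (esingle j) s (DD (esingle i) s f) x - 4 * s * s * hessM f x i j) / (4 * s ^ 2) := by
    field_simp
  rw [e, abs_div, abs_of_pos hs2, div_lt_iff₀ hs2]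
  nlinarith

lemma tele {R ρ M α : ℝ} {f : V3 → ℝ} (hα : α ∈ Ioo (0:ℝ) 1) (hρ : 0 < ρ) (hρR : 8 * ρ = R)
    (hM : 0 ≤ M) (hf : ContDiffOn ℝ 2 f (cube 0 R))
    (h3 : ∀ a b c : Fin 3, ∀ x ∈ cube 0 (4 * ρ), ∀ y1 ∈ Icc 0 ρ, ∀ y2 ∈ Icc 0 ρ, ∀ y3 ∈ Icc 0 ρ,
      |DD (esingle a) y1 (DD (esingle b) y2 (DD (esingle c) y3 f)) x|
        ≤ M * PP ((2 + α) / 3) y1 y2 y3)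
    (i j : Fin 3) {x : V3} (hx : x ∈ cube 0 (2 * ρ)) {h : ℝ} (hh : 0 < h) (hhρ : h ≤ ρ / 2) :
    |DD (esingle j) h (DD (esingle i) h f) x / (4 * h ^ 2) - hessM f x i j|
      ≤ M * h ^ α / (1 - 2 ^ (-α)) := by
  -- one step
  have step : ∀ (k : Fin 3) (s : ℝ), 0 < s → s ≤ ρ / 2 → ∀ z ∈ cube 0 (3 * ρ),
      |DD (esingle j) s (DD (esingle i) s f) (z + s • esingle k)
        - DD (esingle j) s (DD (esingle i) s f) z| ≤ M * (s ^ 2 * s ^ α) := by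
    intro k s hs hsρ z hz
    have hz' : z + (s / 2) • esingle k ∈ cube 0 (4 * ρ) :=
      shift_mem (y := ρ) k hz (by rw [abs_of_pos (by positivity)]; linarith) (by linarith)
    have := h3 k j i _ hz' (s / 2) ⟨by positivity, by linarith⟩ s ⟨hs.le, by linarith⟩ s
      ⟨hs.le, by linarith⟩
    have e : DD (esingle k) (s / 2) (DD (esingle j) s (DD (esingle i) s f)) (z + (s / 2) • esingle k)
        = DD (esingle j) s (DD (esingle i) s f) (z + s • esingle k)
        - DD (esingle j) s (DD (esingle i) s f) z := by
      generalize DD (esingle j) s (DD (esingle i) s f) = g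
      simp only [DD]
      rw [add_sub_cancel_right, add_assoc, ← add_smul, add_halves]
    rw [e] at this
    refine this.trans ?_
    rw [← PP_diag hs]
    have hg : 0 ≤ (2 + α) / 3 := by linarith [hα.1]
    have : (s / 2) ^ ((2 + α) / 3) ≤ s ^ ((2 + α) / 3) :=
      Real.rpow_le_rpow (by positivity) (by linarith) hg
    unfold PP
    gcongr
  have step' : ∀ (k : Fin 3) (s : ℝ), 0 < s → s ≤ ρ / 2 → ∀ z ∈ cube 0 (2.5 * ρ),
      |DD (esingle j) s (DD (esingle i) s f) (z - s • esingle k)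
        - DD (esingle j) s (DD (esingle i) s f) z| ≤ M * (s ^ 2 * s ^ α) := by
    intro k s hs hsρ z hz
    have hz' : z - s • esingle k ∈ cube 0 (3 * ρ) :=
      shift_mem' (y := ρ / 2) k hz (by rw [abs_of_pos (by positivity)]; linarith) (by linarith)
    have := step k s hs hsρ _ hz'
    rwa [sub_add_cancel, abs_sub_comm] at this
  have mono : ∀ z ∈ cube 0 (2.5 * ρ), z ∈ cube 0 (3 * ρ) := by
    intro z hz
    rw [mem_cube0] at *; intro k; linarith [hz k]
  have hx' : x ∈ cube 0 (2.5 * ρ) := by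
    rw [mem_cube0] at *; intro k; linarith [hx k]
  have dbl : ∀ s : ℝ, 0 < s → s ≤ ρ / 2 →
      |DD (esingle j) (2 * s) (DD (esingle i) (2 * s) f) x / (4 * (2 * s) ^ 2)
        - DD (esingle j) s (DD (esingle i) s f) x / (4 * s ^ 2)| ≤ M * s ^ α / 2 := by
    intro s hs hsρ
    have hp : x + s • esingle j ∈ cube 0 (2.5 * ρ) :=
      shift_mem (y := ρ / 2) j hx (by rw [abs_of_pos (by positivity)]; linarith) (by linarith)
    have hn : x - s • esingle j ∈ cube 0 (2.5 * ρ) :=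
      shift_mem' (y := ρ / 2) j hx (by rw [abs_of_pos (by positivity)]; linarith) (by linarith)
    have k1 := step j s hs hsρ x (mono _ hx')
    have k2 := step' j s hs hsρ x hx'
    have k3 := step i s hs hsρ _ (mono _ hp)
    have k4 := step' i s hs hsρ _ hp
    have k5 := step i s hs hsρ _ (mono _ hn)
    have k6 := step' i s hs hsρ _ hn
    have e := DD_four (esingle j) (esingle i) s f x
    have hs2 : 0 < 16 * s ^ 2 := by positivity
    have e2 : DD (esingle j) (2 * s) (DD (esingle i) (2 * s) f) x / (4 * (2 * s) ^ 2)
        - DD (esingle j) s (DD (esingle i) s f) x / (4 * s ^ 2) =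
        (DD (esingle j) (2 * s) (DD (esingle i) (2 * s) f) x
          - 4 * DD (esingle j) s (DD (esingle i) s f) x) / (16 * s ^ 2) := by
      field_simp; ring
    rw [e2, abs_div, abs_of_pos hs2, div_le_iff₀ hs2, e]
    rw [abs_le] at *
    constructor <;> linarith [k1.1, k1.2, k2.1, k2.2, k3.1, k3.2, k4.1, k4.2, k5.1, k5.2, k6.1, k6.2]
  set r : ℝ := 2 ^ (-α) with hr
  have hr0 : 0 < r := by positivity
  have hr1 : r < 1 := by
    rw [hr]; exact Real.rpow_lt_one_of_one_lt_of_neg (by norm_num) (by linarith [hα.1])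
  set A : ℕ → ℝ := fun n =>
    DD (esingle j) (h / 2 ^ n) (DD (esingle i) (h / 2 ^ n) f) x / (4 * (h / 2 ^ n) ^ 2) with hA
  have hpow : ∀ n : ℕ, (h / 2 ^ n) ^ α = h ^ α * r ^ n := by
    intro n
    rw [Real.div_rpow hh.le (by positivity), div_eq_mul_inv, ← Real.rpow_neg (by positivity),
      ← Real.rpow_natCast, ← Real.rpow_natCast, ← Real.rpow_mul (by norm_num), hr,
      ← Real.rpow_mul (by norm_num)]
    congr 2; ring
  have hA1 : ∀ n, dist (A n) (A (n + 1)) ≤ M * h ^ α * r ^ n := by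
    intro n
    have hle : h / 2 ^ (n + 1) ≤ ρ / 2 := (div_le_self hh.le (one_le_pow₀ (by norm_num))).trans hhρ
    have := dbl (h / 2 ^ (n + 1)) (by positivity) hle
    have e : 2 * (h / 2 ^ (n + 1)) = h / 2 ^ n := by rw [pow_succ]; field_simp
    rw [e, hpow] at this
    rw [Real.dist_eq]
    refine this.trans ?_
    have p : 0 ≤ M * h ^ α * r ^ n := by positivity
    rw [pow_succ]
    nlinarith
  have hA2 : Tendsto A atTop (𝓝 (hessM f x i j)) := by
    have l := hess_lim hf (by linarith : 2 * ρ < R) hx i j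
    refine l.comp (f := fun n : ℕ => h / 2 ^ n) ?_
    refine tendsto_nhdsWithin_iff.2 ⟨?_, Eventually.of_forall fun n => ?_⟩
    · have := (tendsto_pow_atTop_nhds_zero_of_lt_one (r := (1/2 : ℝ)) (by norm_num)
        (by norm_num)).const_mul h
      simp only [mul_zero] at this
      refine this.congr fun n => ?_
      rw [div_pow, one_pow, mul_one_div]
    · simp only [mem_Ioi]; positivity
  have := dist_le_of_le_geometric_of_tendsto₀ r (M * h ^ α) hr1 hA1 hA2
  rw [Real.dist_eq] at this
  simpa [hA] using this

/-- Schauder estimate for frozen coefficients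
(Proposition 6 of the paper). -/
theorem schauder_frozen_coefficients :
    ∃ C : ℝ → ℝ,
      ∀ α ∈ Set.Ioo (0 : ℝ) 1, 0 < C α ∧
      ∀ (R T ω Ω : ℝ), 0 < R → 0 < T → 0 < ω → ω ≤ Ω →
      ∀ b : ℝ → Mat3,
        (∀ t ∈ Set.Icc (0 : ℝ) T, (b t).IsSymm) →
        (∀ t ∈ Set.Icc (0 : ℝ) T, ∀ ξ : V3,
          ω * ‖ξ‖ ^ 2 ≤ quadForm (b t) ξ ∧ quadForm (b t) ξ ≤ Ω * ‖ξ‖ ^ 2) →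
      ∀ u : ℝ → V3 → ℝ,
        -- C¹ in time and C² in velocity up to the boundary of Q̄
        (∀ v ∈ ccube R, ContDiffOn ℝ 1 (fun t => u t v) (Set.Icc (0 : ℝ) T)) →
        (∀ t ∈ Set.Icc (0 : ℝ) T, ContDiffOn ℝ 2 (u t) (ccube R)) →
      ∀ N₀ N₁ N₂ : ℝ,
        -- [u₀]_{2+α,(−R,R)³} ≤ N₀
        (∀ v ∈ ccube R, ∀ w ∈ ccube R, ∀ i j : Fin 3,
          |hessW (u 0) (ccube R) v i j - hessW (u 0) (ccube R) w i j| ≤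
            N₀ * ‖v - w‖ ^ α) →
        -- [∂_t u − L u]_{α,Q} ≤ N₁
        (∀ t ∈ Set.Icc (0 : ℝ) T, ∀ v ∈ ccube R, ∀ w ∈ ccube R,
          |(derivWithin (fun s => u s v) (Set.Icc (0 : ℝ) T) t -
              matDot (b t) (hessW (u t) (ccube R) v)) -
            (derivWithin (fun s => u s w) (Set.Icc (0 : ℝ) T) t -
              matDot (b t) (hessW (u t) (ccube R) w))| ≤ N₁ * ‖v - w‖ ^ α) →
        -- ‖∇²u‖_{L^∞(Q)} ≤ N₂
        (∀ t ∈ Set.Icc (0 : ℝ) T, ∀ v ∈ ccube R,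
          matNorm (hessW (u t) (ccube R) v) ≤ N₂) →
      ∀ t ∈ Set.Icc (0 : ℝ) T, ∀ i j kk : Fin 3, ∀ h : ℝ, h ∈ Set.Ioc (0 : ℝ) R →
        |hessW (u t) (ccube R) (h • esingle kk) i j -
            hessW (u t) (ccube R) ((-h) • esingle kk) i j| / (2 * h) ^ α ≤
          C α * (N₀ + ω⁻¹ * N₁ + R ^ (-α) * (1 + ω⁻¹ * Ω) * N₂) := by
  refine ⟨fun α => 8 * (8 + 144 / ((2 + α) / 3 * (1 - (2 + α) / 3))) *
    (2 * (1 / (1 - 2 ^ (-α))) + 1), fun α hα => ?_⟩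
  beta_reduce
  set g := (2 + α) / 3 * (1 - (2 + α) / 3) with hg
  have hg0 : 0 < g := mul_pos (by linarith [hα.1]) (by linarith [hα.2])
  have hr1 : (2:ℝ) ^ (-α) < 1 :=
    Real.rpow_lt_one_of_one_lt_of_neg (by norm_num) (by linarith [hα.1])
  set q : ℝ := 1 / (1 - 2 ^ (-α)) with hq
  have hq0 : 0 < q := one_div_pos.2 (by linarith)
  set c := 8 + 144 / g with hc
  have hc8 : 8 ≤ c := by
    have : 0 < 144 / g := by positivity
    linarith
  have hc0 : 0 < c := by linarith
  refine ⟨by positivity, ?_⟩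
  intro R T ω Ω hR hT hω hωΩ b hbs hbe u hut husp N₀ N₁ N₂ H0 H1 H2 t ht i j kk h hh
  have hΩ : 0 < Ω := hω.trans_le hωΩ
  have h0T : (0:ℝ) ∈ Icc (0:ℝ) T := ⟨le_rfl, hT.le⟩
  have z0 : (0 : V3) ∈ ccube R := by intro k; simpa using hR.le
  have hsm : ∀ (k : Fin 3) (s : ℝ), |s| ≤ R → s • esingle k ∈ ccube R := by
    intro k s hs l
    simp only [PiLp.smul_apply, smul_eq_mul, abs_mul]
    calc |s| * |esingle k l| ≤ |s| * 1 := by gcongr; exact esingle_abs_le k l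
      _ ≤ R := by linarith
  have e0 := hsm 0 R (abs_of_pos hR).le
  have hnR : ‖R • esingle 0 - (0 : V3)‖ = R := by
    rw [sub_zero, norm_smul, esingle_norm, mul_one, Real.norm_eq_abs, abs_of_pos hR]
  have hRα : 0 < R ^ α := by positivity
  have hN0 : 0 ≤ N₀ := by
    have := (abs_nonneg _).trans (H0 _ e0 _ z0 0 0)
    rw [hnR] at this
    exact nonneg_of_mul_nonneg_left this hRα
  have hN1 : 0 ≤ N₁ := by
    have := (abs_nonneg _).trans (H1 0 h0T _ e0 _ z0)
    rw [hnR] at this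
    exact nonneg_of_mul_nonneg_left this hRα
  have hent : ∀ (A : Mat3) (i j : Fin 3), |A i j| ≤ matNorm A := by
    intro A i j
    unfold matNorm
    apply Real.abs_le_sqrt
    refine le_trans ?_ (Finset.single_le_sum (f := fun i => ∑ j, A i j ^ 2)
      (fun i _ => Finset.sum_nonneg fun j _ => sq_nonneg _) (Finset.mem_univ i))
    exact Finset.single_le_sum (f := fun j => A i j ^ 2) (fun j _ => sq_nonneg _)
      (Finset.mem_univ j)
  have H2' : ∀ t ∈ Icc (0:ℝ) T, ∀ v ∈ ccube R, ∀ i j, |hessW (u t) (ccube R) v i j| ≤ N₂ :=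
    fun t ht v hv i j => (hent _ i j).trans (H2 t ht v hv)
  have hN2 : 0 ≤ N₂ := (abs_nonneg _).trans (H2' 0 h0T 0 z0 0 0)
  set S := N₀ + ω⁻¹ * N₁ + R ^ (-α) * (1 + ω⁻¹ * Ω) * N₂ with hS
  have hRn : 0 < R ^ (-α) := by positivity
  have n1 : 0 ≤ ω⁻¹ * N₁ := by positivity
  have n3 : 0 ≤ R ^ (-α) * (1 + ω⁻¹ * Ω) * N₂ := by positivity
  have hS2 : R ^ (-α) * N₂ ≤ S := by
    have : 0 ≤ R ^ (-α) * (ω⁻¹ * Ω) * N₂ := by positivity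
    rw [hS]; linarith
  have hS0 : 0 ≤ S := by rw [hS]; linarith
  have h8 : (R / 8) ^ (-α) ≤ 8 * R ^ (-α) := by
    rw [Real.div_rpow hR.le (by norm_num), Real.rpow_neg (by norm_num : (0:ℝ) ≤ 8), div_inv_eq_mul,
      mul_comm]
    gcongr
    calc (8:ℝ) ^ α ≤ 8 ^ (1:ℝ) := Real.rpow_le_rpow_of_exponent_le (by norm_num) hα.2.le
      _ = 8 := by simp
  obtain ⟨hh0, hhR⟩ := hh
  have h2h : 0 < (2 * h) ^ α := by positivity
  rw [div_le_iff₀ h2h]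
  rcases le_or_gt h (R / 16) with hsmall | hlarge
  · -- small h
    set ρ := R / 8 with hρ
    have hρ0 : 0 < ρ := by positivity
    have hρR : 8 * ρ = R := by rw [hρ]; ring
    have husp' : ∀ t ∈ Icc (0:ℝ) T, ContDiffOn ℝ 2 (u t) (cube 0 R) := fun t ht =>
      (husp t ht).mono (cube_sub R)
    have hder : ∀ t ∈ Icc (0:ℝ) T, ∀ v ∈ cube 0 R, HasDerivWithinAt (fun s => u s v)
        (derivWithin (fun s => u s v) (Icc 0 T) t) (Icc 0 T) t := fun t ht v hv =>
      (((hut v (cube_sub R hv)).differentiableOn (by norm_num)) t ht).hasDerivWithinAt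
    have k2 : ∀ t ∈ Icc (0:ℝ) T, ∀ v ∈ cube 0 R, ∀ i j, |hessM (u t) v i j| ≤ N₂ := by
      intro t ht v hv i j
      rw [← hessW_eq (u t) R v hv]
      exact H2' t ht v (cube_sub R hv) i j
    have k0 : ∀ v ∈ cube 0 R, ∀ w ∈ cube 0 R, ∀ i j,
        |hessM (u 0) v i j - hessM (u 0) w i j| ≤ N₀ * ‖v - w‖ ^ α := by
      intro v hv w hw i j
      rw [← hessW_eq (u 0) R v hv, ← hessW_eq (u 0) R w hw]
      exact H0 v (cube_sub R hv) w (cube_sub R hw) i j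
    have k1 : ∀ t ∈ Icc (0:ℝ) T, ∀ v ∈ cube 0 R, ∀ w ∈ cube 0 R,
        |(derivWithin (fun s => u s v) (Icc 0 T) t - matDot (b t) (hessM (u t) v))
          - (derivWithin (fun s => u s w) (Icc 0 T) t - matDot (b t) (hessM (u t) w))|
          ≤ N₁ * ‖v - w‖ ^ α := by
      intro t ht v hv w hw
      rw [← hessW_eq (u t) R v hv, ← hessW_eq (u t) R w hw]
      exact H1 t ht v (cube_sub R hv) w (cube_sub R hw)
    have hcont := joint_cont hR hN2 u
      (fun v hv => (hut v (cube_sub R hv)).continuousOn) husp' k2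
    have h3 := fun (a b' c' : Fin 3) (x : V3) (hx : x ∈ cube 0 (4 * ρ)) (y1 : ℝ)
        (hy1 : y1 ∈ Icc 0 ρ) (y2 : ℝ) (hy2 : y2 ∈ Icc 0 ρ) (y3 : ℝ) (hy3 : y3 ∈ Icc 0 ρ) =>
      third_abs hα hρ0 hρR hω hΩ.le hN0 hN1 hN2 b hbs hbe u
        (fun t v => derivWithin (fun s => u s v) (Icc 0 T) t) hcont hder husp' k0 k1 k2 a b' c' x hx
        t ht y1 y2 y3 hy1 hy2 hy3
    rw [← hg, ← hc] at h3
    set M := c * (N₀ + ω⁻¹ * N₁ + ρ ^ (-α) * (1 + ω⁻¹ * Ω) * N₂) with hM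
    have hM0 : 0 ≤ M := by positivity
    have hMS : M ≤ 8 * c * S := by
      have i1 : ρ ^ (-α) * (1 + ω⁻¹ * Ω) * N₂ ≤ 8 * R ^ (-α) * (1 + ω⁻¹ * Ω) * N₂ := by gcongr
      have : N₀ + ω⁻¹ * N₁ + ρ ^ (-α) * (1 + ω⁻¹ * Ω) * N₂ ≤ 8 * S := by
        rw [hS]; linarith
      rw [hM]
      calc _ ≤ c * (8 * S) := by gcongr
        _ = _ := by ring
    have zc : ∀ r : ℝ, 0 < r → (0 : V3) ∈ cube 0 r := by
      intro r hr; rw [mem_cube0]; intro k; simpa using hr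
    have hp : h • esingle kk ∈ cube 0 (2 * ρ) := by
      have := shift_mem (R := 2 * ρ) (y := ρ) (s := h) kk (zc ρ hρ0)
        (by rw [abs_of_pos hh0]; linarith) (by linarith)
      rwa [zero_add] at this
    have hn : (-h) • esingle kk ∈ cube 0 (2 * ρ) := by
      have := shift_mem (R := 2 * ρ) (y := ρ) (s := -h) kk (zc ρ hρ0)
        (by rw [abs_neg, abs_of_pos hh0]; linarith) (by linarith)
      rwa [zero_add] at this
    have mR : ∀ v ∈ cube 0 (2 * ρ), v ∈ cube 0 R := by
      intro v hv; rw [mem_cube0] at *; intro k; linarith [hv k]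
    rw [hessW_eq _ R _ (mR _ hp), hessW_eq _ R _ (mR _ hn)]
    have t1 := tele hα hρ0 hρR hM0 (husp' t ht) h3 i j hp hh0 (by linarith)
    have t2 := tele hα hρ0 hρR hM0 (husp' t ht) h3 i j hn hh0 (by linarith)
    have t3 := h3 kk j i 0 (zc _ (by linarith)) h ⟨hh0.le, by linarith⟩ h ⟨hh0.le, by linarith⟩
      h ⟨hh0.le, by linarith⟩
    have e3 : DD (esingle kk) h (DD (esingle j) h (DD (esingle i) h (u t))) 0
        = DD (esingle j) h (DD (esingle i) h (u t)) (h • esingle kk)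
        - DD (esingle j) h (DD (esingle i) h (u t)) ((-h) • esingle kk) := by
      generalize DD (esingle j) h (DD (esingle i) h (u t)) = F
      simp only [DD, zero_add, zero_sub, neg_smul]
    rw [e3, PP_diag hh0] at t3
    have t4 : |DD (esingle j) h (DD (esingle i) h (u t)) (h • esingle kk) / (4 * h ^ 2)
        - DD (esingle j) h (DD (esingle i) h (u t)) ((-h) • esingle kk) / (4 * h ^ 2)|
        ≤ M * h ^ α := by
      have h4 : 0 < 4 * h ^ 2 := by positivity
      have p : 0 ≤ M * (h ^ 2 * h ^ α) := by positivity
      rw [← sub_div, abs_div, abs_of_pos h4, div_le_iff₀ h4]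
      linarith
    have eq1 : M * h ^ α / (1 - 2 ^ (-α)) = M * h ^ α * q := by rw [hq]; ring
    rw [eq1] at t1 t2
    have tot : |hessM (u t) (h • esingle kk) i j - hessM (u t) ((-h) • esingle kk) i j|
        ≤ M * h ^ α * (2 * q + 1) := by
      rw [abs_le] at *
      constructor <;> linarith [t1.1, t1.2, t2.1, t2.2, t4.1, t4.2]
    refine tot.trans ?_
    have hle : h ^ α ≤ (2 * h) ^ α := Real.rpow_le_rpow hh0.le (by linarith) hα.1.le
    calc M * h ^ α * (2 * q + 1) ≤ (8 * c * S) * (2 * h) ^ α * (2 * q + 1) := by gcongr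
      _ = _ := by ring
  · have a1 := H2' t ht _ (hsm kk h (by rw [abs_of_pos hh0]; exact hhR)) i j
    have a2 := H2' t ht _ (hsm kk (-h) (by rw [abs_neg, abs_of_pos hh0]; exact hhR)) i j
    have a3 : |hessW (u t) (ccube R) (h • esingle kk) i j -
            hessW (u t) (ccube R) ((-h) • esingle kk) i j| ≤ 2 * N₂ := by
      rw [abs_le] at *
      constructor <;> linarith [a1.1, a1.2, a2.1, a2.2]
    refine a3.trans ?_
    have b1 : (R / 8) ^ α ≤ (2 * h) ^ α :=
      Real.rpow_le_rpow (by positivity) (by linarith) hα.1.le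
    have b2 : (R / 8) ^ (-α) * (R / 8) ^ α = 1 := by
      rw [← Real.rpow_add (by positivity)]; simp
    calc 2 * N₂ = 2 * N₂ * ((R / 8) ^ (-α) * (R / 8) ^ α) := by rw [b2, mul_one]
      _ ≤ 2 * N₂ * (8 * R ^ (-α) * (2 * h) ^ α) := by gcongr
      _ = 16 * (R ^ (-α) * N₂) * (2 * h) ^ α := by ring
      _ ≤ 16 * S * (2 * h) ^ α := by gcongr
      _ ≤ 8 * c * (2 * q + 1) * S * (2 * h) ^ α := by
        gcongr
        nlinarith

end
end
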